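/- Let (M^n, E, ⟨,⟩, D, φ) with n ≥ 3 be an admissible GCF-manifold, and let φ̌: TM^n → E be the smooth extension of v ↦ φ(Â(v)). Then (M^n, E, ⟨,⟩, D, φ̌) is also an admissible GCF-manifold, and the double dual φ̌̌ coincides with φ (the duality operation is an involution on admissible GCF-manifolds). -/

import Mathlib

noncomputable section

namespace Loc

open Matrix

variable {n : ℕ}

/-- Points of the local coordinate chart `ℝⁿ`. -/
abbrev Pt (n : ℕ) := Fin n → ℝ

/-- `n × n` real matrices. -/
abbrev Mat (n : ℕ) := Matrix (Fin n) (Fin n) ℝ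

/-- `i`-th partial derivative of a scalar function on `ℝⁿ`. -/
def pd (i : Fin n) (f : Pt n → ℝ) (p : Pt n) : ℝ :=
  fderiv ℝ f p (Pi.single i 1)

/-- Christoffel symbols `Γ^k_{ij}` of a metric `g` (as a matrix-valued function). -/
def christoffel (g : Pt n → Mat n) (k i j : Fin n) (p : Pt n) : ℝ :=
  (1 / 2) * ∑ l, (g p)⁻¹ k l *
    (pd i (fun q => g q j l) p + pd j (fun q => g q i l) p - pd l (fun q => g q i j) p)

/-- Curvature tensor `R^l{}_{kij}` of `g`, i.e. `R(∂ᵢ,∂ⱼ)∂ₖ = Σ_l riemann g l i j k • ∂_l`. -/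
def riemann (g : Pt n → Mat n) (l i j k : Fin n) (p : Pt n) : ℝ :=
  pd i (christoffel g l j k) p - pd j (christoffel g l i k) p
    + ∑ m, (christoffel g l i m p * christoffel g m j k p
      - christoffel g l j m p * christoffel g m i k p)

/-- Ricci tensor `R_{jk}` of `g`. -/
def ricci (g : Pt n → Mat n) (j k : Fin n) (p : Pt n) : ℝ :=
  ∑ i, riemann g i i j k p

/-- Scalar curvature `S_g`. -/
def scalarCurv (g : Pt n → Mat n) (p : Pt n) : ℝ :=
  ∑ j, ∑ k, (g p)⁻¹ j k * ricci g j k p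

/-- The Schouten tensor `A = (1/(n-2)) (Ric - S_g/(2(n-1)) g)` of `g`. -/
def schouten (g : Pt n → Mat n) (p : Pt n) : Mat n :=
  (1 / (n - 2 : ℝ)) •
    Matrix.of (fun i j => ricci g i j p - scalarCurv g p / (2 * (n - 1 : ℝ)) * g p i j)

/-- `g` is flat (vanishing curvature, hence vanishing sectional curvature) on `s`. -/
def FlatOn (g : Pt n → Mat n) (s : Set (Pt n)) : Prop :=
  ∀ p ∈ s, ∀ l i j k, riemann g l i j k p = 0

/-- `g` is conformally flat on `s`: around each point of `s` some conformal multiple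
`e^{2σ} g` has vanishing curvature. -/
def ConformallyFlatOn (g : Pt n → Mat n) (s : Set (Pt n)) : Prop :=
  ∀ p ∈ s, ∃ V : Set (Pt n), IsOpen V ∧ p ∈ V ∧ V ⊆ s ∧ ∃ σ : Pt n → ℝ,
    ContDiffOn ℝ (⊤ : ℕ∞) σ V ∧ FlatOn (fun q => Real.exp (2 * σ q) • g q) V

/-- A coherent tangent bundle over a coordinate domain `U ⊆ ℝⁿ`, in the trivialization
`e₁,…,e_n` of the rank-`n` bundle `E`: `h` is the fiber metric `⟨e_a,e_b⟩`, `ω` are the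
connection coefficients (`D_{∂ᵢ} e_b = Σ_a (ω i) a b • e_a`) and `φ` is the bundle
homomorphism (`φ(∂_j) = Σ_a φ a j • e_a`). -/
structure CTB (n : ℕ) where
  U : Set (Pt n)
  h : Pt n → Mat n
  ω : Fin n → Pt n → Mat n
  φ : Pt n → Mat n

namespace CTB

/-- `f` is a smooth bundle homomorphism `TM → E` satisfying the coherence condition
`D_X f(Y) - D_Y f(X) - f([X,Y]) = 0`. -/
def IsCoherentHom (d : CTB n) (f : Pt n → Mat n) : Prop :=
  (∀ a j, ContDiffOn ℝ (⊤ : ℕ∞) (fun p => f p a j) d.U) ∧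
  ∀ p ∈ d.U, ∀ a i j,
    pd i (fun q => f q a j) p + ∑ b, d.ω i p a b * f p b j
      = pd j (fun q => f q a i) p + ∑ b, d.ω j p a b * f p b i

/-- The axioms of a coherent tangent bundle: `U` open, `h` a smooth fiber metric,
`ω` a smooth metric connection, and `φ` a coherent smooth bundle homomorphism. -/
def IsCTB (d : CTB n) : Prop :=
  IsOpen d.U ∧
  (∀ a b, ContDiffOn ℝ (⊤ : ℕ∞) (fun p => d.h p a b) d.U) ∧
  (∀ p ∈ d.U, (d.h p).IsSymm ∧ (d.h p).PosDef) ∧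
  (∀ i a b, ContDiffOn ℝ (⊤ : ℕ∞) (fun p => d.ω i p a b) d.U) ∧
  (∀ p ∈ d.U, ∀ i a b,
    pd i (fun q => d.h q a b) p
      = (∑ c, d.ω i p c a * d.h p c b) + ∑ c, d.ω i p c b * d.h p a c) ∧
  d.IsCoherentHom d.φ

/-- The pull-back metric `g = φ*⟨,⟩`, i.e. `g_{ij} = ⟨φ(∂ᵢ), φ(∂ⱼ)⟩`. -/
def gmet (d : CTB n) : Pt n → Mat n := fun p => (d.φ p)ᵀ * d.h p * d.φ p

/-- The regular set of `φ` (points of `U` where `φ` is injective). -/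
def reg (d : CTB n) : Set (Pt n) := {p | p ∈ d.U ∧ (d.φ p).det ≠ 0}

/-- A generalized conformally flat manifold: a coherent tangent bundle with `n ≥ 3`,
dense regular set, and conformally flat pull-back metric on the regular set. -/
def IsGCF (d : CTB n) : Prop :=
  3 ≤ n ∧ d.IsCTB ∧ d.U ⊆ closure d.reg ∧ ConformallyFlatOn d.gmet d.reg

/-- The Schouten tensor of the pull-back metric. -/
def schoutenT (d : CTB n) : Pt n → Mat n := fun p => schouten d.gmet p

/-- The set `R*` of non-parabolic regular points (where the Schouten tensor is
non-degenerate). -/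
def regStar (d : CTB n) : Set (Pt n) := {p | p ∈ d.reg ∧ (d.schoutenT p).det ≠ 0}

/-- The dual metric `ǧ_{ij} = Σ_{a,b} A_{ia} A_{jb} g^{ab}` (in matrix form `A g⁻¹ A`,
using the symmetry of `A` and `g`). -/
def dualMet (d : CTB n) : Pt n → Mat n :=
  fun p => d.schoutenT p * (d.gmet p)⁻¹ * d.schoutenT p

/-- The tensor `Â = Σ g^{ia} A_{aj} ∂ᵢ ⊗ du^j`, i.e. `g⁻¹ A` in matrix form. -/
def Ahat (d : CTB n) : Pt n → Mat n := fun p => (d.gmet p)⁻¹ * d.schoutenT p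

/-- `ψ` is a smooth bundle homomorphism extending `φ ∘ Â` (defined on the regular set)
to all of `U`. -/
def IsDualHom (d : CTB n) (ψ : Pt n → Mat n) : Prop :=
  (∀ a j, ContDiffOn ℝ (⊤ : ℕ∞) (fun p => ψ p a j) d.U) ∧
  ∀ p ∈ d.reg, ψ p = d.φ p * d.Ahat p

/-- An admissible GCF-manifold: `R*` is dense and `φ ∘ Â` extends smoothly to `U`. -/
def IsAdmissible (d : CTB n) : Prop :=
  d.IsGCF ∧ d.U ⊆ closure d.regStar ∧ ∃ ψ, d.IsDualHom ψ

end CTB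

end Loc

set_option linter.unusedSectionVars false
noncomputable section
namespace Loc
namespace Aux
open Matrix

/-- smooth at a point -/
abbrev Sm {n : ℕ} (f : Pt n → ℝ) (p : Pt n) : Prop := ContDiffAt ℝ (⊤ : ℕ∞) f p

section pdcalc
variable {n : ℕ} {p : Pt n} {f g : Pt n → ℝ} (i j : Fin n)

theorem Sm.da (hf : Sm f p) : DifferentiableAt ℝ f p := hf.differentiableAt (by simp)

theorem pd_add (hf : Sm f p) (hg : Sm g p) :
    pd i (fun q => f q + g q) p = pd i f p + pd i g p := by
  unfold pd
  rw [fderiv_fun_add hf.da hg.da]; rfl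

theorem pd_sub (hf : Sm f p) (hg : Sm g p) :
    pd i (fun q => f q - g q) p = pd i f p - pd i g p := by
  unfold pd
  rw [fderiv_fun_sub hf.da hg.da]; rfl

theorem pd_mul (hf : Sm f p) (hg : Sm g p) :
    pd i (fun q => f q * g q) p = pd i f p * g p + f p * pd i g p := by
  unfold pd
  rw [fderiv_fun_mul hf.da hg.da]; simp; ring

theorem pd_sum {ι : Type*} [Fintype ι] {f : ι → Pt n → ℝ} (hf : ∀ k, Sm (f k) p) :
    pd i (fun q => ∑ k, f k q) p = ∑ k, pd i (f k) p := by
  unfold pd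
  rw [fderiv_fun_sum (fun k _ => (hf k).da)]; simp

theorem pd_congr {s : Set (Pt n)} (hs : IsOpen s) (hp : p ∈ s) (h : ∀ q ∈ s, f q = g q) :
    pd i f p = pd i g p := by
  unfold pd
  rw [Filter.EventuallyEq.fderiv_eq (Filter.eventuallyEq_of_mem (hs.mem_nhds hp) h)]

theorem Sm.pd (hf : Sm f p) : Sm (pd i f) p := by
  have : ContDiffAt ℝ (⊤ : ℕ∞) (fderiv ℝ f) p := hf.fderiv_right (by norm_cast)
  exact this.clm_apply contDiffAt_const

theorem pd_comm (hf : Sm f p) : Loc.pd i (Loc.pd j f) p = Loc.pd j (Loc.pd i f) p := by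
  have h1 : ContDiffAt ℝ (⊤ : ℕ∞) (fderiv ℝ f) p := hf.fderiv_right (by norm_cast)
  have h2 : DifferentiableAt ℝ (fderiv ℝ f) p := h1.differentiableAt (by simp)
  have hs : IsSymmSndFDerivAt ℝ f p := hf.isSymmSndFDerivAt (by simp; norm_cast)
  have key : ∀ v w : Pt n, fderiv ℝ (fun q => fderiv ℝ f q v) p w = fderiv ℝ (fderiv ℝ f) p w v := by
    intro v w
    rw [fderiv_clm_apply h2 (by fun_prop)]
    simp
  unfold Loc.pd
  rw [key, key]
  exact hs _ _

theorem Sm.congr {s : Set (Pt n)} (hs : IsOpen s) (hp : p ∈ s) (hf : Sm f p)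
    (h : ∀ q ∈ s, g q = f q) : Sm g p :=
  hf.congr_of_eventuallyEq (Filter.eventuallyEq_of_mem (hs.mem_nhds hp) h)

end pdcalc

/-- entrywise derivative of a matrix function -/
def pdM {n : ℕ} {α β : Type*} (i : Fin n) (A : Pt n → Matrix α β ℝ) (p : Pt n) : Matrix α β ℝ :=
  Matrix.of fun a b => pd i (fun q => A q a b) p

/-- entrywise derivative of a vector function -/
def pdV {n : ℕ} {α : Type*} (i : Fin n) (s : Pt n → α → ℝ) (p : Pt n) : α → ℝ :=
  fun a => pd i (fun q => s q a) p

def SmM {n : ℕ} {α β : Type*} (A : Pt n → Matrix α β ℝ) (p : Pt n) : Prop :=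
  ∀ a b, Sm (fun q => A q a b) p

def SmV {n : ℕ} {α : Type*} (s : Pt n → α → ℝ) (p : Pt n) : Prop :=
  ∀ a, Sm (fun q => s q a) p

section rules
variable {n : ℕ} {p : Pt n} {α β γ : Type*} [Fintype α] [Fintype β] [Fintype γ]
  {A A' : Pt n → Matrix α β ℝ} {B : Pt n → Matrix β γ ℝ} {s s' : Pt n → β → ℝ}
  {t : Pt n → α → ℝ} {f : Pt n → ℝ} (i j : Fin n)

theorem sm_sum {ι : Type*} [Fintype ι] {f : ι → Pt n → ℝ} (hf : ∀ k, Sm (f k) p) :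
    Sm (fun q => ∑ k, f k q) p := ContDiffAt.sum (fun k _ => hf k)

theorem SmM.mul (hA : SmM A p) (hB : SmM B p) : SmM (fun q => A q * B q) p := by
  intro a b
  simp only [Matrix.mul_apply]
  exact sm_sum fun k => (hA a k).mul (hB k b)

theorem SmM.transpose (hA : SmM A p) : SmM (fun q => (A q)ᵀ) p := fun a b => hA b a

theorem SmM.add (hA : SmM A p) (hB : SmM A' p) : SmM (fun q => A q + A' q) p :=
  fun a b => (hA a b).add (hB a b)

theorem SmM.sub (hA : SmM A p) (hB : SmM A' p) : SmM (fun q => A q - A' q) p :=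
  fun a b => (hA a b).sub (hB a b)

theorem SmM.smul (hf : Sm f p) (hA : SmM A p) : SmM (fun q => f q • A q) p :=
  fun a b => hf.mul (hA a b)

theorem SmM.mulVec (hA : SmM A p) (hs : SmV s p) : SmV (fun q => A q *ᵥ s q) p := by
  intro a
  simp only [Matrix.mulVec, dotProduct]
  exact sm_sum fun k => (hA a k).mul (hs k)

theorem SmV.add (hs : SmV s p) (hs' : SmV s' p) : SmV (fun q => s q + s' q) p :=
  fun a => (hs a).add (hs' a)

theorem SmV.sub (hs : SmV s p) (hs' : SmV s' p) : SmV (fun q => s q - s' q) p :=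
  fun a => (hs a).sub (hs' a)

theorem SmV.smul (hf : Sm f p) (hs : SmV s p) : SmV (fun q => f q • s q) p :=
  fun a => hf.mul (hs a)

theorem SmV.dot (hs : SmV s p) (hs' : SmV s' p) : Sm (fun q => s q ⬝ᵥ s' q) p :=
  sm_sum fun k => (hs k).mul (hs' k)

theorem SmV.vecMulVec (ht : SmV t p) (hs : SmV s p) : SmM (fun q => vecMulVec (t q) (s q)) p :=
  fun a b => (ht a).mul (hs b)

theorem SmM.pdM (hA : SmM A p) : SmM (pdM i A) p := fun a b => (hA a b).pd i

theorem SmV.pdV (hs : SmV s p) : SmV (pdV i s) p := fun a => (hs a).pd i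

theorem pdM_mul (hA : SmM A p) (hB : SmM B p) :
    pdM i (fun q => A q * B q) p = pdM i A p * B p + A p * pdM i B p := by
  ext a b
  simp only [Aux.pdM, Matrix.mul_apply, Matrix.add_apply, Matrix.of_apply]
  rw [pd_sum i (fun k => (hA a k).mul (hB k b)), ← Finset.sum_add_distrib]
  exact Finset.sum_congr rfl fun k _ => pd_mul i (hA a k) (hB k b)

theorem pdM_add (hA : SmM A p) (hB : SmM A' p) :
    pdM i (fun q => A q + A' q) p = pdM i A p + pdM i A' p := by
  ext a b
  exact pd_add i (hA a b) (hB a b)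

theorem pdM_sub (hA : SmM A p) (hB : SmM A' p) :
    pdM i (fun q => A q - A' q) p = pdM i A p - pdM i A' p := by
  ext a b
  exact pd_sub i (hA a b) (hB a b)

theorem pdM_smul (hf : Sm f p) (hA : SmM A p) :
    pdM i (fun q => f q • A q) p = pd i f p • A p + f p • pdM i A p := by
  ext a b
  exact pd_mul i hf (hA a b)

theorem pdV_smul (hf : Sm f p) (hs : SmV s p) :
    pdV i (fun q => f q • s q) p = pd i f p • s p + f p • pdV i s p := by
  ext a
  exact pd_mul i hf (hs a)

theorem pdV_add (hs : SmV s p) (hs' : SmV s' p) :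
    pdV i (fun q => s q + s' q) p = pdV i s p + pdV i s' p := by
  ext a
  exact pd_add i (hs a) (hs' a)

theorem pdV_sub (hs : SmV s p) (hs' : SmV s' p) :
    pdV i (fun q => s q - s' q) p = pdV i s p - pdV i s' p := by
  ext a
  exact pd_sub i (hs a) (hs' a)

theorem pdV_mulVec (hA : SmM A p) (hs : SmV s p) :
    pdV i (fun q => A q *ᵥ s q) p = pdM i A p *ᵥ s p + A p *ᵥ pdV i s p := by
  ext a
  simp only [Aux.pdM, Aux.pdV, Matrix.mulVec, dotProduct, Pi.add_apply, Matrix.of_apply]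
  rw [pd_sum i (fun k => (hA a k).mul (hs k)), ← Finset.sum_add_distrib]
  exact Finset.sum_congr rfl fun k _ => pd_mul i (hA a k) (hs k)

theorem pd_dot (hs : SmV s p) (hs' : SmV s' p) :
    pd i (fun q => s q ⬝ᵥ s' q) p = pdV i s p ⬝ᵥ s' p + s p ⬝ᵥ pdV i s' p := by
  simp only [Aux.pdV, dotProduct]
  rw [pd_sum i (fun k => (hs k).mul (hs' k)), ← Finset.sum_add_distrib]
  exact Finset.sum_congr rfl fun k _ => pd_mul i (hs k) (hs' k)

theorem pdM_vecMulVec (ht : SmV t p) (hs : SmV s p) :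
    pdM i (fun q => vecMulVec (t q) (s q)) p
      = vecMulVec (pdV i t p) (s p) + vecMulVec (t p) (pdV i s p) := by
  ext a b
  exact pd_mul i (ht a) (hs b)

theorem pdM_congr {S : Set (Pt n)} (hS : IsOpen S) (hp : p ∈ S) (h : ∀ q ∈ S, A q = A' q) :
    pdM i A p = pdM i A' p := by
  ext a b
  exact pd_congr i hS hp fun q hq => by rw [h q hq]

theorem pdV_congr {S : Set (Pt n)} (hS : IsOpen S) (hp : p ∈ S) (h : ∀ q ∈ S, s q = s' q) :
    pdV i s p = pdV i s' p := by
  ext a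
  exact pd_congr i hS hp fun q hq => by rw [h q hq]

theorem pdM_comm (hA : SmM A p) : Aux.pdM i (Aux.pdM j A) p = Aux.pdM j (Aux.pdM i A) p := by
  ext a b
  exact pd_comm i j (hA a b)

theorem pdV_comm (hs : SmV s p) : Aux.pdV i (Aux.pdV j s) p = Aux.pdV j (Aux.pdV i s) p := by
  ext a
  exact pd_comm i j (hs a)

theorem SmM.det [DecidableEq β] {A : Pt n → Matrix β β ℝ} (hA : SmM A p) :
    Sm (fun q => (A q).det) p := by
  simp only [Matrix.det_apply']
  apply ContDiffAt.sum
  intro σ _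
  apply contDiffAt_const.mul
  apply contDiffAt_prod
  intro k _
  exact hA _ _

theorem SmM.inv [DecidableEq β] {A : Pt n → Matrix β β ℝ} (hA : SmM A p) (h0 : (A p).det ≠ 0) :
    SmM (fun q => (A q)⁻¹) p := by
  intro a b
  simp only [Matrix.inv_def, Matrix.smul_apply, Ring.inverse_eq_inv', smul_eq_mul,
    Matrix.adjugate_apply]
  refine (hA.det.inv h0).mul (SmM.det ?_)
  intro c d
  by_cases hc : c = b
  · subst hc; simp only [Matrix.updateRow_self]; exact contDiffAt_const
  · simp only [Matrix.updateRow_ne hc]; exact hA c d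

end rules
end Aux
end Loc
end

set_option linter.unusedSectionVars false
noncomputable section
namespace Loc
namespace Aux
open Matrix

variable {n : ℕ}

/-- metric connection data -/
structure Conn (U : Set (Pt n)) (h : Pt n → Mat n) (ω : Fin n → Pt n → Mat n) : Prop where
  op : IsOpen U
  smh : ∀ p ∈ U, SmM h p
  symm : ∀ p ∈ U, (h p)ᵀ = h p
  posdef : ∀ p ∈ U, (h p).PosDef
  smw : ∀ p ∈ U, ∀ i, SmM (ω i) p
  met : ∀ p ∈ U, ∀ i, pdM i h p = (ω i p)ᵀ * h p + h p * ω i p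

/-- j-th column of a matrix function -/
def cl (φ : Pt n → Mat n) (j : Fin n) : Pt n → Fin n → ℝ := fun q a => φ q a j

/-- covariant derivative of a section -/
def DV (ω : Fin n → Pt n → Mat n) (i : Fin n) (s : Pt n → Fin n → ℝ) (p : Pt n) : Fin n → ℝ :=
  pdV i s p + ω i p *ᵥ s p

structure Coh (U : Set (Pt n)) (ω : Fin n → Pt n → Mat n) (φ : Pt n → Mat n) : Prop where
  sm : ∀ p ∈ U, SmM φ p
  coh : ∀ p ∈ U, ∀ i j, DV ω i (cl φ j) p = DV ω j (cl φ i) p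

theorem sm_of_on {U : Set (Pt n)} (hU : IsOpen U) {f : Pt n → ℝ}
    (hf : ContDiffOn ℝ (⊤ : ℕ∞) f U) {p : Pt n} (hp : p ∈ U) : Sm f p :=
  hf.contDiffAt (hU.mem_nhds hp)

theorem on_of_sm {U : Set (Pt n)} {f : Pt n → ℝ} (hf : ∀ p ∈ U, Sm f p) :
    ContDiffOn ℝ (⊤ : ℕ∞) f U := fun p hp => (hf p hp).contDiffWithinAt

theorem coh_iff {d : CTB n} (hU : IsOpen d.U) (f : Pt n → Mat n) :
    d.IsCoherentHom f ↔ Coh d.U d.ω f := by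
  constructor
  · rintro ⟨h1, h2⟩
    refine ⟨fun p hp a b => sm_of_on hU (h1 a b) hp, fun p hp i j => ?_⟩
    ext a
    exact h2 p hp a i j
  · rintro ⟨h1, h2⟩
    refine ⟨fun a b => on_of_sm fun p hp => h1 p hp a b, fun p hp a i j => ?_⟩
    exact congrFun (h2 p hp i j) a

theorem ctb_iff {d : CTB n} : d.IsCTB ↔ Conn d.U d.h d.ω ∧ Coh d.U d.ω d.φ := by
  constructor
  · rintro ⟨h1, h2, h3, h4, h5, h6⟩
    refine ⟨⟨h1, fun p hp a b => sm_of_on h1 (h2 a b) hp, fun p hp => (h3 p hp).1,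
      fun p hp => (h3 p hp).2, fun p hp i a b => sm_of_on h1 (h4 i a b) hp, fun p hp i => ?_⟩,
      (coh_iff h1 _).1 h6⟩
    ext a b
    refine (h5 p hp i a b).trans ?_
    simp only [Matrix.add_apply, Matrix.mul_apply, Matrix.transpose_apply]
    congr 1
    exact Finset.sum_congr rfl fun c _ => mul_comm _ _
  · rintro ⟨⟨h1, h2, h3, h3', h4, h5⟩, h6⟩
    refine ⟨h1, fun a b => on_of_sm fun p hp => h2 p hp a b, fun p hp => ⟨h3 p hp, h3' p hp⟩,
      fun i a b => on_of_sm fun p hp => h4 p hp i a b, fun p hp i a b => ?_,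
      (coh_iff h1 _).2 h6⟩
    refine (congrFun (congrFun (h5 p hp i) a) b).trans ?_
    simp only [Matrix.add_apply, Matrix.mul_apply, Matrix.transpose_apply]
    congr 1
    exact Finset.sum_congr rfl fun c _ => mul_comm _ _

/-- curvature of the connection -/
def Om (ω : Fin n → Pt n → Mat n) (i j : Fin n) (p : Pt n) : Mat n :=
  pdM i (ω j) p - pdM j (ω i) p + ω i p * ω j p - ω j p * ω i p

def met (h φ : Pt n → Mat n) : Pt n → Mat n := fun p => (φ p)ᵀ * h p * φ p

/-- Christoffel symbols as matrices -/
def Gam (g : Pt n → Mat n) (i : Fin n) (p : Pt n) : Mat n := of fun k j => christoffel g k i j p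

section gauge
variable {U : Set (Pt n)} {h φ : Pt n → Mat n} {ω : Fin n → Pt n → Mat n}

theorem Conn.unit (H : Conn U h ω) {p : Pt n} (hp : p ∈ U) : IsUnit (h p).det :=
  (H.posdef p hp).det_pos.ne'.isUnit

theorem met_det (H : Conn U h ω) {p : Pt n} (hp : p ∈ U) (h0 : (φ p).det ≠ 0) :
    (met h φ p).det ≠ 0 := by
  simp only [met, det_mul, det_transpose]
  have := (H.posdef p hp).det_pos.ne'
  positivity

theorem met_inv (H : Conn U h ω) {p : Pt n} (hp : p ∈ U) (h0 : (φ p).det ≠ 0) :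
    φ p * (met h φ p)⁻¹ * (φ p)ᵀ * h p = 1 := by
  have h1 : IsUnit (φ p).det := h0.isUnit
  have h2 : IsUnit (φ p)ᵀ.det := by simpa using h1
  have h3 := H.unit hp
  simp only [met]
  rw [Matrix.mul_inv_rev, Matrix.mul_inv_rev]
  rw [← Matrix.mul_assoc, Matrix.mul_nonsing_inv _ h1, Matrix.one_mul]
  rw [Matrix.nonsing_inv_mul_cancel_right _ _ h2, Matrix.nonsing_inv_mul _ h3]

theorem met_sm (H : Conn U h ω) (C : Coh U ω φ) {p : Pt n} (hp : p ∈ U) : SmM (met h φ) p :=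
  (((C.sm p hp).transpose).mul (H.smh p hp)).mul (C.sm p hp)

theorem pd_met (H : Conn U h ω) (C : Coh U ω φ) {p : Pt n} (hp : p ∈ U) (i : Fin n) :
    pdM i (met h φ) p = (pdM i φ p + ω i p * φ p)ᵀ * h p * φ p
      + (φ p)ᵀ * h p * (pdM i φ p + ω i p * φ p) := by
  have s1 := C.sm p hp
  have s2 := H.smh p hp
  have e : pdM i (met h φ) p = _ := pdM_mul i (s1.transpose.mul s2) s1
  rw [e, pdM_mul i s1.transpose s2, H.met p hp]
  have : pdM i (fun q => (φ q)ᵀ) p = (pdM i φ p)ᵀ := rfl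
  rw [this, transpose_add, transpose_mul]
  simp only [Matrix.mul_add, Matrix.add_mul, Matrix.mul_assoc]
  abel

theorem gam_eq (H : Conn U h ω) (C : Coh U ω φ) {p : Pt n} (hp : p ∈ U)
    (i : Fin n) :
    Gam (met h φ) i p = (met h φ p)⁻¹ * ((φ p)ᵀ * h p * (pdM i φ p + ω i p * φ p)) := by
  set N : Fin n → Mat n := fun i => pdM i φ p + ω i p * φ p with hN
  have symN : ∀ i j a, N i a j = N j a i := fun i j a => congrFun (C.coh p hp i j) a
  set Cc : Fin n → Mat n := fun i => (φ p)ᵀ * h p * N i with hC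
  have symC : ∀ i j l, Cc i l j = Cc j l i := by
    intro i j l
    simp only [hC, Matrix.mul_apply (M := (φ p)ᵀ * h p)]
    exact Finset.sum_congr rfl fun a _ => by rw [symN]
  have hg : ∀ i j l, pd i (fun q => met h φ q j l) p = Cc i l j + Cc i j l := by
    intro i j l
    have := congrFun (congrFun (pd_met H C hp i) j) l
    refine this.trans ?_
    rw [Matrix.add_apply]
    congr 1
    have : ((N i)ᵀ * h p * φ p) = (Cc i)ᵀ := by
      simp only [hC, transpose_mul, transpose_transpose, H.symm p hp, Matrix.mul_assoc]
    exact congrFun (congrFun this j) l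
  ext k j
  simp only [Gam, of_apply, christoffel, Matrix.mul_apply (M := (met h φ p)⁻¹)]
  rw [Finset.mul_sum]
  refine Finset.sum_congr rfl fun l _ => ?_
  rw [hg, hg, hg]
  change _ = _ * Cc i l j
  rw [symC j i l, symC i l j, symC j l i]
  ring

theorem phi_gam (H : Conn U h ω) (C : Coh U ω φ) {p : Pt n} (hp : p ∈ U) (h0 : (φ p).det ≠ 0)
    (i : Fin n) : φ p * Gam (met h φ) i p = pdM i φ p + ω i p * φ p := by
  rw [gam_eq H C hp, ← Matrix.mul_assoc, ← Matrix.mul_assoc, ← Matrix.mul_assoc,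
    met_inv H hp h0, Matrix.one_mul]

theorem reg_open (H : Conn U h ω) (C : Coh U ω φ) : IsOpen {p | p ∈ U ∧ (φ p).det ≠ 0} := by
  rw [isOpen_iff_mem_nhds]
  rintro p ⟨hp, h0⟩
  have := ((C.sm p hp).det.continuousAt).eventually_ne h0
  filter_upwards [this, H.op.mem_nhds hp] with q h1 h2 using ⟨h2, h1⟩

theorem gam_sm (H : Conn U h ω) (C : Coh U ω φ) {p : Pt n} (hp : p ∈ U) (h0 : (φ p).det ≠ 0)
    (i : Fin n) : SmM (Gam (met h φ) i) p := by
  have s1 := C.sm p hp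
  have s2 : SmM (fun q => (met h φ q)⁻¹ * ((φ q)ᵀ * h q * (pdM i φ q + ω i q * φ q))) p :=
    ((met_sm H C hp).inv (met_det H hp h0)).mul ((s1.transpose.mul (H.smh p hp)).mul
      ((s1.pdM i).add ((H.smw p hp i).mul s1)))
  intro a b
  exact (s2 a b).congr H.op hp fun q hq => by rw [gam_eq H C hq]

/-- curvature tensor as matrices -/
def Rm (g : Pt n → Mat n) (i j : Fin n) (p : Pt n) : Mat n := of fun l k => riemann g l i j k p

theorem Rm_eq (g : Pt n → Mat n) (i j : Fin n) (p : Pt n) :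
    Rm g i j p = pdM i (Gam g j) p - pdM j (Gam g i) p
      + (Gam g i p * Gam g j p - Gam g j p * Gam g i p) := by
  ext l k
  simp only [Rm, of_apply, riemann, Matrix.add_apply, Matrix.sub_apply, Matrix.mul_apply, pdM, Gam,
    Finset.sum_sub_distrib]

theorem phi_Rm (H : Conn U h ω) (C : Coh U ω φ) {p : Pt n} (hp : p ∈ U) (h0 : (φ p).det ≠ 0)
    (i j : Fin n) : φ p * Rm (met h φ) i j p = Om ω i j p * φ p := by
  have s1 := C.sm p hp
  have key : ∀ i j, pdM i φ p * Gam (met h φ) j p + φ p * pdM i (Gam (met h φ) j) p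
      = pdM i (pdM j φ) p + (pdM i (ω j) p * φ p + ω j p * pdM i φ p) := by
    intro i j
    rw [← pdM_mul i s1 (gam_sm H C hp h0 j), ← pdM_mul i (H.smw p hp j) s1,
      ← pdM_add i (s1.pdM j) ((H.smw p hp j).mul s1)]
    exact pdM_congr i (reg_open H C) ⟨hp, h0⟩ fun q hq => phi_gam H C hq.1 hq.2 j
  have e : ∀ i, pdM i φ p = φ p * Gam (met h φ) i p - ω i p * φ p := fun i => by
    rw [phi_gam H C hp h0 i]; abel
  have k1 := key i j
  have k2 := key j i
  rw [pdM_comm j i s1] at k2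
  rw [e i] at k1
  rw [e j] at k2
  have k3 := congrArg₂ (· - ·) k1 k2
  rw [Rm_eq, Om]
  generalize Gam (met h φ) i p = Gi at *
  generalize Gam (met h φ) j p = Gj at *
  generalize pdM i (Gam (met h φ) j) p = a at *
  generalize pdM j (Gam (met h φ) i) p = b at *
  generalize pdM i (pdM j φ) p = z at *
  generalize pdM i (ω j) p = x at *
  generalize pdM j (ω i) p = y at *
  generalize φ p = f at *
  generalize ω i p = wi at *
  generalize ω j p = wj at *
  rw [← sub_eq_zero] at k3 ⊢
  rw [← k3]
  noncomm_ring

end gauge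
end Aux
end Loc
end

set_option linter.unusedSectionVars false
noncomputable section
namespace Loc
namespace Aux
open Matrix

variable {n : ℕ}

def wedge (h : Mat n) (a b : Fin n → ℝ) : Mat n :=
  vecMulVec a (h *ᵥ b) - vecMulVec b (h *ᵥ a)

def ip (h : Mat n) (a b : Fin n → ℝ) : ℝ := a ⬝ᵥ (h *ᵥ b)

theorem ip_comm {h : Mat n} (hs : hᵀ = h) (a b : Fin n → ℝ) : ip h a b = ip h b a := by
  unfold ip
  rw [dotProduct_mulVec, dotProduct_comm, ← mulVec_transpose, hs]

theorem ip_add_left (h : Mat n) (a b c : Fin n → ℝ) : ip h (a + b) c = ip h a c + ip h b c := by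
  simp [ip, add_dotProduct]
theorem ip_sub_left (h : Mat n) (a b c : Fin n → ℝ) : ip h (a - b) c = ip h a c - ip h b c := by
  simp [ip, sub_dotProduct]
theorem ip_smul_left (h : Mat n) (r : ℝ) (a c : Fin n → ℝ) : ip h (r • a) c = r * ip h a c := by
  simp [ip]
theorem ip_add_right (h : Mat n) (a b c : Fin n → ℝ) : ip h c (a + b) = ip h c a + ip h c b := by
  simp [ip, mulVec_add]
theorem ip_sub_right (h : Mat n) (a b c : Fin n → ℝ) : ip h c (a - b) = ip h c a - ip h c b := by
  simp [ip, mulVec_sub]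
theorem ip_smul_right (h : Mat n) (r : ℝ) (a c : Fin n → ℝ) : ip h c (r • a) = r * ip h c a := by
  simp [ip, mulVec_smul]

theorem wedge_mulVec {h : Mat n} (hs : hᵀ = h) (a b c : Fin n → ℝ) :
    wedge h a b *ᵥ c = ip h b c • a - ip h a c • b := by
  have : ∀ b c : Fin n → ℝ, (h *ᵥ b) ⬝ᵥ c = ip h b c := fun b c => by
    rw [dotProduct_comm]; exact ip_comm hs c b
  ext k
  simp [wedge, sub_mulVec, vecMulVec_mulVec, this]

theorem wedge_add_left (h : Mat n) (a b c : Fin n → ℝ) :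
    wedge h (a + b) c = wedge h a c + wedge h b c := by
  ext k l; simp [wedge, vecMulVec_apply, mulVec_add]; ring
theorem wedge_sub_left (h : Mat n) (a b c : Fin n → ℝ) :
    wedge h (a - b) c = wedge h a c - wedge h b c := by
  ext k l; simp [wedge, vecMulVec_apply, mulVec_sub]; ring
theorem wedge_smul_left (h : Mat n) (r : ℝ) (a c : Fin n → ℝ) :
    wedge h (r • a) c = r • wedge h a c := by
  ext k l; simp [wedge, vecMulVec_apply, mulVec_smul]; ring
theorem wedge_swap (h : Mat n) (a b : Fin n → ℝ) : wedge h a b = - wedge h b a := by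
  simp [wedge]
theorem wedge_add_right (h : Mat n) (a b c : Fin n → ℝ) :
    wedge h c (a + b) = wedge h c a + wedge h c b := by
  ext k l; simp [wedge, vecMulVec_apply, mulVec_add]; ring
theorem wedge_sub_right (h : Mat n) (a b c : Fin n → ℝ) :
    wedge h c (a - b) = wedge h c a - wedge h c b := by
  ext k l; simp [wedge, vecMulVec_apply, mulVec_sub]; ring
theorem wedge_smul_right (h : Mat n) (r : ℝ) (a c : Fin n → ℝ) :
    wedge h c (r • a) = r • wedge h c a := by
  ext k l; simp [wedge, vecMulVec_apply, mulVec_smul]; ring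

theorem wedge_skew {h : Mat n} (hs : hᵀ = h) (a b : Fin n → ℝ) :
    (wedge h a b)ᵀ * h + h * wedge h a b = 0 := by
  simp only [wedge, transpose_sub, transpose_vecMulVec, Matrix.sub_mul, Matrix.mul_sub,
    vecMulVec_mul, mul_vecMulVec, ← mulVec_transpose, hs]
  abel

theorem wedge_comm {h : Mat n} (hs : hᵀ = h) (a b u : Fin n → ℝ) :
    wedge h a u * wedge h b u - wedge h b u * wedge h a u
      = ip h b u • wedge h a u - ip h a u • wedge h b u - ip h u u • wedge h a b := by
  have e : ∀ b c : Fin n → ℝ, (h *ᵥ b) ⬝ᵥ c = ip h b c := fun b c => by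
    rw [dotProduct_comm]; exact ip_comm hs c b
  simp only [wedge, Matrix.sub_mul, Matrix.mul_sub, vecMulVec_mul_vecMulVec, e, ip_comm hs u a,
    ip_comm hs u b, ip_comm hs b a]
  ext k l
  simp only [Matrix.sub_apply, Matrix.smul_apply, vecMulVec_apply, Pi.smul_apply, smul_eq_mul]
  ring

section
variable {U : Set (Pt n)} {h φ : Pt n → Mat n} {ω : Fin n → Pt n → Mat n}
  {s t u : Pt n → Fin n → ℝ} {σ : Pt n → ℝ}

theorem DV_h (H : Conn U h ω) {p : Pt n} (hp : p ∈ U) (ht : SmV t p) (i : Fin n) :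
    pdV i (fun q => h q *ᵥ t q) p = (h p *ᵥ t p) ᵥ* ω i p + h p *ᵥ DV ω i t p := by
  rw [pdV_mulVec i (H.smh p hp) ht, H.met p hp, DV, add_mulVec, mulVec_add, ← mulVec_transpose,
    mulVec_mulVec, mulVec_mulVec]
  abel

theorem pd_ip (H : Conn U h ω) {p : Pt n} (hp : p ∈ U) (hs : SmV s p) (ht : SmV t p) (i : Fin n) :
    pd i (fun q => ip (h q) (s q) (t q)) p
      = ip (h p) (DV ω i s p) (t p) + ip (h p) (s p) (DV ω i t p) := by
  unfold ip
  have e1 : DV ω i s p = pdV i s p + ω i p *ᵥ s p := rfl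
  rw [pd_dot i hs ((H.smh p hp).mulVec ht), DV_h H hp ht, e1, add_dotProduct, dotProduct_add]
  have : s p ⬝ᵥ ((h p *ᵥ t p) ᵥ* ω i p) = (ω i p *ᵥ s p) ⬝ᵥ (h p *ᵥ t p) := by
    rw [dotProduct_comm, ← dotProduct_mulVec, dotProduct_comm]
  rw [this]
  ring

theorem pd_wedge (H : Conn U h ω) {p : Pt n} (hp : p ∈ U) (hs : SmV s p) (ht : SmV t p)
    (i : Fin n) :
    pdM i (fun q => wedge (h q) (s q) (t q)) p
      = wedge (h p) (DV ω i s p) (t p) + wedge (h p) (s p) (DV ω i t p)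
        - (ω i p * wedge (h p) (s p) (t p) - wedge (h p) (s p) (t p) * ω i p) := by
  have hh := H.smh p hp
  unfold wedge
  rw [pdM_sub i (hs.vecMulVec (hh.mulVec ht)) (ht.vecMulVec (hh.mulVec hs)),
    pdM_vecMulVec i hs (hh.mulVec ht), pdM_vecMulVec i ht (hh.mulVec hs),
    DV_h H hp hs, DV_h H hp ht]
  simp only [Matrix.mul_sub, Matrix.sub_mul, mul_vecMulVec, vecMulVec_mul]
  ext k l
  simp only [DV, Matrix.sub_apply, Matrix.add_apply, vecMulVec_apply, Pi.add_apply]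
  ring

theorem SmV.wedge (hh : SmM h p) (hs : SmV s p) (ht : SmV t p) :
    SmM (fun q => wedge (h q) (s q) (t q)) p :=
  (hs.vecMulVec (hh.mulVec ht)).sub (ht.vecMulVec (hh.mulVec hs))

theorem SmV.ip (hh : SmM h p) (hs : SmV s p) (ht : SmV t p) :
    Sm (fun q => ip (h q) (s q) (t q)) p := hs.dot (hh.mulVec ht)

theorem Coh.smc (C : Coh U ω φ) {p : Pt n} (hp : p ∈ U) (i : Fin n) : SmV (cl φ i) p :=
  fun a => C.sm p hp a i

theorem DV_sm (H : Conn U h ω) {p : Pt n} (hp : p ∈ U) (hs : SmV s p) (i : Fin n) :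
    SmV (DV ω i s) p := (hs.pdV i).add ((H.smw p hp i).mulVec hs)

theorem DV_smul {f : Pt n → ℝ} {p : Pt n} (hf : Sm f p) (hs : SmV s p) (i : Fin n) :
    DV ω i (fun q => f q • s q) p = pd i f p • s p + f p • DV ω i s p := by
  simp only [DV, pdV_smul i hf hs, mulVec_smul, smul_add]
  abel
theorem DV_add {p : Pt n} (hs : SmV s p) (ht : SmV t p) (i : Fin n) :
    DV ω i (fun q => s q + t q) p = DV ω i s p + DV ω i t p := by
  simp only [DV, pdV_add i hs ht, mulVec_add]
  abel
theorem DV_sub {p : Pt n} (hs : SmV s p) (ht : SmV t p) (i : Fin n) :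
    DV ω i (fun q => s q - t q) p = DV ω i s p - DV ω i t p := by
  simp only [DV, pdV_sub i hs ht, mulVec_sub]
  abel
theorem DV_congr (hU : IsOpen U) {p : Pt n} (hp : p ∈ U) (e : ∀ q ∈ U, s q = t q) (i : Fin n) :
    DV ω i s p = DV ω i t p := by
  simp only [DV, pdV_congr i hU hp e, e p hp]

theorem DV_comm (H : Conn U h ω) {p : Pt n} (hp : p ∈ U) (hs : SmV s p) (i j : Fin n) :
    DV ω i (DV ω j s) p - DV ω j (DV ω i s) p = Om ω i j p *ᵥ s p := by
  have key : ∀ i j, DV ω i (DV ω j s) p = pdV i (pdV j s) p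
      + (pdM i (ω j) p *ᵥ s p + ω j p *ᵥ pdV i s p)
      + (ω i p *ᵥ pdV j s p + (ω i p * ω j p) *ᵥ s p) := by
    intro i j
    rw [← pdV_mulVec i (H.smw p hp j) hs, ← pdV_add i (hs.pdV j) ((H.smw p hp j).mulVec hs)]
    rw [← mulVec_mulVec, ← mulVec_add]
    rfl
  rw [key, key, pdV_comm j i hs, Om]
  simp only [add_mulVec, sub_mulVec]
  abel

/-- conformally changed connection -/
def om' (h φ : Pt n → Mat n) (ω : Fin n → Pt n → Mat n) (u : Pt n → Fin n → ℝ) :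
    Fin n → Pt n → Mat n := fun i q => ω i q + wedge (h q) (cl φ i q) (u q)

def th (h φ : Pt n → Mat n) (ω : Fin n → Pt n → Mat n) (u : Pt n → Fin n → ℝ) (i : Fin n) :
    Pt n → Fin n → ℝ := fun q =>
  DV ω i u q - ip (h q) (cl φ i q) (u q) • u q + (1 / 2 * ip (h q) (u q) (u q)) • cl φ i q

theorem conn' (H : Conn U h ω) (C : Coh U ω φ) (hu : ∀ p ∈ U, SmV u p) :
    Conn U h (om' h φ ω u) := by
  refine ⟨H.op, H.smh, H.symm, H.posdef, fun p hp i =>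
    (H.smw p hp i).add (SmV.wedge (H.smh p hp) (C.smc hp i) (hu p hp)), fun p hp i => ?_⟩
  have := wedge_skew (H.symm p hp) (cl φ i p) (u p)
  rw [H.met p hp i, om', transpose_add, Matrix.add_mul, Matrix.mul_add, ← sub_eq_zero,
    ← neg_eq_zero, ← this]
  abel

theorem coh' (H : Conn U h ω) (C : Coh U ω φ) (hσ : ∀ p ∈ U, Sm σ p)
    (hu : ∀ p ∈ U, SmV u p) (e : ∀ p ∈ U, ∀ i, ip (h p) (cl φ i p) (u p) = pd i σ p) :
    Coh U (om' h φ ω u) (fun q => Real.exp (σ q) • φ q) := by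
  have se : ∀ p ∈ U, Sm (fun q => Real.exp (σ q)) p := fun p hp => (hσ p hp).exp
  refine ⟨fun p hp => (C.sm p hp).smul (se p hp), fun p hp i j => ?_⟩
  have he : ∀ i, pd i (fun q => Real.exp (σ q)) p = Real.exp (σ p) * pd i σ p := by
    intro i
    unfold pd
    rw [fderiv_exp (hσ p hp).da]; rfl
  have key : ∀ i j, DV (om' h φ ω u) i (cl (fun q => Real.exp (σ q) • φ q) j) p
      = Real.exp (σ p) • (pd i σ p • cl φ j p + pd j σ p • cl φ i p
        - ip (h p) (cl φ i p) (cl φ j p) • u p + DV ω i (cl φ j) p) := by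
    intro i j
    have : cl (fun q => Real.exp (σ q) • φ q) j = fun q => Real.exp (σ q) • cl φ j q := rfl
    rw [this, DV_smul (se p hp) (C.smc hp j), he]
    have e2 : DV (om' h φ ω u) i (cl φ j) p
      = DV ω i (cl φ j) p + wedge (h p) (cl φ i p) (u p) *ᵥ cl φ j p := by
      simp only [DV, om', add_mulVec]; abel
    rw [e2, wedge_mulVec (H.symm p hp), ip_comm (H.symm p hp) (u p), e p hp]
    module
  rw [key, key, C.coh p hp i j, ip_comm (H.symm p hp) (cl φ i p)]
  module

theorem met' (h φ : Pt n → Mat n) (σ : Pt n → ℝ) :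
    met h (fun q => Real.exp (σ q) • φ q) = fun q => Real.exp (2 * σ q) • met h φ q := by
  funext q
  simp only [met, transpose_smul, Matrix.smul_mul, Matrix.mul_smul, smul_smul]
  rw [two_mul, Real.exp_add]

theorem Om' (H : Conn U h ω) (C : Coh U ω φ) (hu : ∀ p ∈ U, SmV u p) {p : Pt n} (hp : p ∈ U)
    (i j : Fin n) :
    Om (om' h φ ω u) i j p = Om ω i j p + wedge (h p) (cl φ j p) (th h φ ω u i p)
      - wedge (h p) (cl φ i p) (th h φ ω u j p) := by
  have hh := H.smh p hp
  have key : ∀ i j, pdM i (om' h φ ω u j) p = pdM i (ω j) p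
      + (wedge (h p) (DV ω i (cl φ j) p) (u p) + wedge (h p) (cl φ j p) (DV ω i u p)
        - (ω i p * wedge (h p) (cl φ j p) (u p) - wedge (h p) (cl φ j p) (u p) * ω i p)) := by
    intro i j
    rw [← pd_wedge H hp (C.smc hp j) (hu p hp)]
    exact pdM_add i (H.smw p hp j) (SmV.wedge hh (C.smc hp j) (hu p hp))
  have wc := wedge_comm (H.symm p hp) (cl φ i p) (cl φ j p) (u p)
  unfold Om
  rw [key, key, C.coh p hp j i]
  simp only [th, wedge_add_right, wedge_sub_right, wedge_smul_right]
  rw [wedge_swap (h p) (cl φ j p) (cl φ i p)]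
  simp only [om', Matrix.mul_add, Matrix.add_mul]
  rw [← sub_eq_zero] at wc ⊢
  rw [← wc]
  module

/-- symmetry of theta -/
theorem th_symm (H : Conn U h ω) (C : Coh U ω φ) (hσ : ∀ p ∈ U, Sm σ p)
    (hu : ∀ p ∈ U, SmV u p) (e : ∀ p ∈ U, ∀ i, ip (h p) (cl φ i p) (u p) = pd i σ p)
    {p : Pt n} (hp : p ∈ U) (i j : Fin n) :
    ip (h p) (cl φ i p) (th h φ ω u j p) = ip (h p) (cl φ j p) (th h φ ω u i p) := by
  have key : ∀ i j, ip (h p) (cl φ i p) (DV ω j u p)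
      = pd j (pd i σ) p - ip (h p) (DV ω j (cl φ i) p) (u p) := by
    intro i j
    have := pd_ip H hp (C.smc hp i) (hu p hp) j
    rw [pd_congr j H.op hp fun q hq => e q hq i] at this
    rw [this]; ring
  simp only [th, ip_add_right, ip_sub_right, ip_smul_right, key]
  rw [C.coh p hp i j, pd_comm i j (hσ p hp), ip_comm (H.symm p hp) (cl φ i p) (cl φ j p)]
  ring

theorem th_coh (H : Conn U h ω) (C : Coh U ω φ) (hσ : ∀ p ∈ U, Sm σ p)
    (hu : ∀ p ∈ U, SmV u p) (e : ∀ p ∈ U, ∀ i, ip (h p) (cl φ i p) (u p) = pd i σ p)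
    {p : Pt n} (hp : p ∈ U) (i j : Fin n)
    (hΩ : Om ω i j p = wedge (h p) (cl φ i p) (th h φ ω u j p)
      - wedge (h p) (cl φ j p) (th h φ ω u i p)) :
    DV ω i (th h φ ω u j) p = DV ω j (th h φ ω u i) p := by
  have hh := H.smh p hp
  have key : ∀ i j, DV ω i (th h φ ω u j) p = DV ω i (DV ω j u) p
      - (pd i (pd j σ) p • u p + pd j σ p • DV ω i u p)
      + (ip (h p) (DV ω i u p) (u p) • cl φ j p
        + (1 / 2 * ip (h p) (u p) (u p)) • DV ω i (cl φ j) p) := by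
    intro i j
    have s1 := DV_sm H hp (hu p hp) j
    have s2 : SmV (fun q => pd j σ q • u q) p := SmV.smul ((hσ p hp).pd j) (hu p hp)
    have s0 := SmV.ip hh (hu p hp) (hu p hp)
    have s3 : Sm (fun q => 1 / 2 * ip (h q) (u q) (u q)) p := contDiffAt_const.mul s0
    have e1 : ∀ q ∈ U, th h φ ω u j q = DV ω j u q - pd j σ q • u q
        + (1 / 2 * ip (h q) (u q) (u q)) • cl φ j q := by
      intro q hq
      rw [th, e q hq]
    rw [DV_congr H.op hp e1, DV_add (s1.sub s2) (SmV.smul s3 (C.smc hp j)), DV_sub s1 s2,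
      DV_smul ((hσ p hp).pd j) (hu p hp), DV_smul s3 (C.smc hp j)]
    have : pd i (fun q => 1 / 2 * ip (h q) (u q) (u q)) p = ip (h p) (DV ω i u p) (u p) := by
      rw [pd_mul i contDiffAt_const s0, pd_ip H hp (hu p hp) (hu p hp),
        ip_comm (H.symm p hp) (u p) (DV ω i u p)]
      simp [pd]; ring
    rw [this]
  have dc := DV_comm H hp (hu p hp) i j
  rw [hΩ, sub_mulVec, wedge_mulVec (H.symm p hp), wedge_mulVec (H.symm p hp), e p hp, e p hp] at dc
  simp only [th, ip_add_left, ip_sub_left, ip_smul_left, e p hp] at dc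
  rw [key, key, C.coh p hp i j, pd_comm i j (hσ p hp)]
  rw [sub_eq_iff_eq_add] at dc
  rw [dc]
  module

end
end Aux
end Loc
end

set_option linter.unusedSectionVars false
noncomputable section
namespace Loc
namespace Aux
open Matrix

variable {n : ℕ}
section
variable {U : Set (Pt n)} {h φ ψ : Pt n → Mat n} {ω : Fin n → Pt n → Mat n}

theorem T_apply (h φ ψ : Pt n → Mat n) (p : Pt n) (i j : Fin n) :
    ((φ p)ᵀ * h p * ψ p) i j = ip (h p) (cl φ i p) (cl ψ j p) := by
  rw [Matrix.mul_assoc]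
  simp only [Matrix.mul_apply, ip, dotProduct, mulVec, transpose_apply, cl]

theorem wedge_mul_eq (h : Pt n → Mat n) (φ : Pt n → Mat n) (t : Mat n) (p : Pt n)
    (hs : (h p)ᵀ = h p) (ψ : Pt n → Mat n) (ht : ψ p = φ p * t) (i j : Fin n) :
    wedge (h p) (cl φ i p) (cl ψ j p) * φ p = φ p * of fun l k =>
      (if l = i then ((φ p)ᵀ * h p * ψ p) k j else 0) - t l j * met h φ p k i := by
  have e1 : ∀ (χ : Pt n → Mat n) j k, ((h p *ᵥ cl χ j p) ᵥ* φ p) k = ((φ p)ᵀ * h p * χ p) k j := by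
    intro χ j k
    rw [T_apply, ip, vecMul, dotProduct_comm]; rfl
  ext a k
  have e2 : cl ψ j p a = ∑ l, φ p a l * t l j := by
    rw [← Matrix.mul_apply, ← ht]; rfl
  simp only [wedge, Matrix.sub_mul, vecMulVec_mul, Matrix.sub_apply, vecMulVec_apply, e1, e2]
  rw [Matrix.mul_apply (M := φ p)]
  simp only [met]
  generalize (φ p)ᵀ * h p * ψ p = T
  generalize (φ p)ᵀ * h p * φ p = g
  simp only [of_apply, mul_sub, Finset.sum_sub_distrib, Finset.sum_mul, mul_ite, mul_zero,
    Finset.sum_ite_eq', Finset.mem_univ, if_true, mul_assoc, cl]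

theorem schouten_eq (hn : 3 ≤ n) (H : Conn U h ω) (C : Coh U ω φ) {p : Pt n} (hp : p ∈ U)
    (h0 : (φ p).det ≠ 0)
    (hΩ : ∀ i j, Om ω i j p = wedge (h p) (cl φ i p) (cl ψ j p)
      - wedge (h p) (cl φ j p) (cl ψ i p))
    (hsym : ∀ i j, ip (h p) (cl φ i p) (cl ψ j p) = ip (h p) (cl φ j p) (cl ψ i p)) :
    schouten (met h φ) p = (φ p)ᵀ * h p * ψ p := by
  have hu : IsUnit (φ p).det := h0.isUnit
  set t : Mat n := (φ p)⁻¹ * ψ p with ht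
  set T : Mat n := (φ p)ᵀ * h p * ψ p with hT
  set g : Mat n := met h φ p with hg
  have hψ : ψ p = φ p * t := by rw [ht, Matrix.mul_nonsing_inv_cancel_left _ _ hu]
  have hTs : ∀ i j, T i j = T j i := fun i j => by rw [hT, T_apply, T_apply, hsym]
  have hgs : ∀ i j, g i j = g j i := fun i j => by
    show ((φ p)ᵀ * h p * φ p) i j = ((φ p)ᵀ * h p * φ p) j i
    rw [T_apply, T_apply, ip_comm (H.symm p hp)]
  have hgt : g * t = T := by
    rw [hT, hψ, hg, met]; simp only [Matrix.mul_assoc]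
  have hgu : IsUnit g.det := (met_det H hp h0).isUnit
  have hR : ∀ i j l k, riemann (met h φ) l i j k p =
      ((if l = i then T k j else 0) - t l j * g k i)
        - ((if l = j then T k i else 0) - t l i * g k j) := by
    intro i j l k
    have e := phi_Rm H C hp h0 i j
    rw [hΩ, Matrix.sub_mul, wedge_mul_eq h φ t p (H.symm p hp) ψ hψ,
      wedge_mul_eq h φ t p (H.symm p hp) ψ hψ, ← Matrix.mul_sub] at e
    have e' := congrArg (fun X => (φ p)⁻¹ * X) e
    simp only [Matrix.nonsing_inv_mul_cancel_left _ _ hu] at e'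
    exact congrFun (congrFun e' l) k
  have hn1 : (n - 1 : ℝ) ≠ 0 := by
    have : (3:ℝ) ≤ n := by exact_mod_cast hn
    intro h; linarith
  have hn2 : (n - 2 : ℝ) ≠ 0 := by
    have : (3:ℝ) ≤ n := by exact_mod_cast hn
    intro h; linarith
  have hric : ∀ j k, ricci (met h φ) j k p = (n - 2) * T k j + t.trace * g k j := by
    intro j k
    have e : T k j = ∑ i, t i j * g k i := by
      rw [← hgt, Matrix.mul_apply]; exact Finset.sum_congr rfl fun _ _ => mul_comm _ _
    simp only [ricci, hR, Finset.sum_sub_distrib, if_true, Finset.sum_const, Finset.card_univ,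
      Fintype.card_fin, ← e, Finset.sum_ite_eq', Finset.mem_univ, ← Finset.sum_mul, nsmul_eq_mul]
    rw [show ∑ i, t i i = t.trace from rfl]
    ring
  have hsc : scalarCurv (met h φ) p = 2 * (n - 1) * t.trace := by
    have e1 : ∀ X : Mat n, ∑ j, ∑ k, g⁻¹ j k * X k j = (g⁻¹ * X).trace := by
      intro X
      simp only [trace, diag, Matrix.mul_apply]
    have e2 : g⁻¹ * T = t := by rw [← hgt, Matrix.nonsing_inv_mul_cancel_left _ _ hgu]
    have e3 : ∀ j k, g⁻¹ j k * ((n - 2) * T k j + t.trace * g k j)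
        = (n - 2) * (g⁻¹ j k * T k j) + t.trace * (g⁻¹ j k * g k j) := by intro j k; ring
    simp only [scalarCurv, hric, ← hg, e3, Finset.sum_add_distrib, ← Finset.mul_sum]
    rw [e1, e1, e2, Matrix.nonsing_inv_mul _ hgu, Matrix.trace_one, Fintype.card_fin]
    ring
  ext i j
  simp only [schouten, hric, hsc, Matrix.smul_apply, of_apply, smul_eq_mul, ← hg]
  rw [hgs j i, hTs j i]
  field_simp
  ring

theorem phi_Ahat (hn : 3 ≤ n) (H : Conn U h ω) (C : Coh U ω φ) {p : Pt n} (hp : p ∈ U)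
    (h0 : (φ p).det ≠ 0)
    (hΩ : ∀ i j, Om ω i j p = wedge (h p) (cl φ i p) (cl ψ j p)
      - wedge (h p) (cl φ j p) (cl ψ i p))
    (hsym : ∀ i j, ip (h p) (cl φ i p) (cl ψ j p) = ip (h p) (cl φ j p) (cl ψ i p)) :
    φ p * ((met h φ p)⁻¹ * schouten (met h φ) p) = ψ p := by
  rw [schouten_eq hn H C hp h0 hΩ hsym, ← Matrix.mul_assoc, ← Matrix.mul_assoc, ← Matrix.mul_assoc,
    met_inv H hp h0, Matrix.one_mul]

end
end Aux
end Loc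
end

set_option linter.unusedSectionVars false
noncomputable section
namespace Loc
namespace Aux
open Filter Topology Set

section frob
variable {E T : Type*} [NormedAddCommGroup E] [NormedSpace ℝ E] [FiniteDimensional ℝ E]
  [NormedAddCommGroup T] [NormedSpace ℝ T] [CompleteSpace T]

theorem param_hasFDerivAt {F : E × ℝ → T} (hF : ContDiff ℝ 1 F) (x : E) :
    HasFDerivAt (fun x => ∫ t in (0:ℝ)..1, F (x, t))
      (∫ t in (0:ℝ)..1, (fderiv ℝ F (x, t)).comp (ContinuousLinearMap.inl ℝ E ℝ)) x := by
  have hc : Continuous fun z : E × ℝ => (fderiv ℝ F z).comp (ContinuousLinearMap.inl ℝ E ℝ) :=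
    (hF.continuous_fderiv (by simp)).clm_comp continuous_const
  have hK : IsCompact (Metric.closedBall x 1 ×ˢ Icc (0:ℝ) 1) :=
    (isCompact_closedBall x 1).prod isCompact_Icc
  obtain ⟨B, hB⟩ := hK.exists_bound_of_continuousOn hc.continuousOn
  refine intervalIntegral.hasFDerivAt_integral_of_dominated_of_fderiv_le
    (bound := fun _ => B) (s := Metric.closedBall x 1)
    (F' := fun x t => (fderiv ℝ F (x, t)).comp (ContinuousLinearMap.inl ℝ E ℝ))
    (Metric.closedBall_mem_nhds x one_pos) ?_ ?_ ?_ ?_ ?_ ?_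
  · exact Eventually.of_forall fun y =>
      (hF.continuous.comp (by fun_prop : Continuous fun t : ℝ => (y, t))).aestronglyMeasurable
  · exact (hF.continuous.comp
      (by fun_prop : Continuous fun t : ℝ => (x, t))).intervalIntegrable _ _
  · exact (hc.comp (by fun_prop : Continuous fun t : ℝ => (x, t))).aestronglyMeasurable
  · refine Eventually.of_forall fun t ht y hy => hB (y, t) ⟨hy, ?_⟩
    rw [uIoc_of_le zero_le_one] at ht
    exact ⟨ht.1.le, ht.2⟩
  · exact intervalIntegrable_const
  · refine Eventually.of_forall fun t ht y hy => ?_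
    have h1 : HasFDerivAt F (fderiv ℝ F (y, t)) (y, t) :=
      (hF.differentiable (by simp) _).hasFDerivAt
    have h2 : HasFDerivAt (fun y : E => (y, t)) (ContinuousLinearMap.inl ℝ E ℝ) y := by
      exact hasFDerivAt_prodMk_left y t
    exact h1.comp y h2

theorem param_contDiff {F : E × ℝ → T} (hF : ContDiff ℝ 1 F) :
    ContDiff ℝ 1 (fun x => ∫ t in (0:ℝ)..1, F (x, t)) := by
  rw [contDiff_one_iff_fderiv]
  refine ⟨fun x => (param_hasFDerivAt hF x).differentiableAt, ?_⟩
  have : (fderiv ℝ fun x => ∫ t in (0:ℝ)..1, F (x, t)) = fun x =>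
    (∫ t in (0:ℝ)..1, (fderiv ℝ F (x, t)).comp (ContinuousLinearMap.inl ℝ E ℝ)) :=
    funext fun x => (param_hasFDerivAt hF x).fderiv
  rw [this]
  apply intervalIntegral.continuous_parametric_intervalIntegral_of_continuous'
  have hc : Continuous fun z : E × ℝ => (fderiv ℝ F z).comp (ContinuousLinearMap.inl ℝ E ℝ) :=
    (hF.continuous_fderiv (by simp)).clm_comp continuous_const
  exact hc

variable (A : E → E →L[ℝ] T →L[ℝ] T)

/-- one Picard step along rays -/
def pic (y0 : T) (S : E → T) (x : E) : T :=
  y0 + ∫ t in (0:ℝ)..1, A (t • x) x (S (t • x))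

def picF (S : E → T) (z : E × ℝ) : T := A (z.2 • z.1) z.1 (S (z.2 • z.1))

variable {A}

theorem picF_contDiff (hA : ContDiff ℝ 1 A) {S : E → T} (hS : ContDiff ℝ 1 S) :
    ContDiff ℝ 1 (picF A S) := by
  unfold picF
  have h1 : ContDiff ℝ 1 fun z : E × ℝ => z.2 • z.1 := contDiff_snd.smul contDiff_fst
  exact ((hA.comp h1).clm_apply contDiff_fst).clm_apply (hS.comp h1)

theorem pic_contDiff (hA : ContDiff ℝ 1 A) (y0 : T) {S : E → T} (hS : ContDiff ℝ 1 S) :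
    ContDiff ℝ 1 (pic A y0 S) :=
  contDiff_const.add (param_contDiff (picF_contDiff hA hS))

/-- the derivative of a Picard step -/
theorem pic_fderiv (hA : ContDiff ℝ 1 A) (y0 : T) {S : E → T} (hS : ContDiff ℝ 1 S) (x v : E) :
    fderiv ℝ (pic A y0 S) x v = ∫ t in (0:ℝ)..1,
      (t • fderiv ℝ A (t • x) v x (S (t • x)) + A (t • x) v (S (t • x))
        + t • A (t • x) x (fderiv ℝ S (t • x) v)) := by
  have hF := picF_contDiff hA hS
  have h1 : HasFDerivAt (pic A y0 S) _ x := (param_hasFDerivAt hF x).const_add y0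
  rw [h1.fderiv]
  have hc : Continuous fun t : ℝ =>
      (fderiv ℝ (picF A S) (x, t)).comp (ContinuousLinearMap.inl ℝ E ℝ) :=
    ((hF.continuous_fderiv (by simp)).comp (by fun_prop : Continuous fun t : ℝ => (x, t))).clm_comp
      continuous_const
  rw [ContinuousLinearMap.intervalIntegral_apply (hc.intervalIntegrable _ _)]
  congr 1
  ext t
  have e1 : HasFDerivAt (fun y : E => t • y) (t • ContinuousLinearMap.id ℝ E) x :=
    (hasFDerivAt_id x).const_smul t
  have e2 : HasFDerivAt (fun y : E => A (t • y)) _ x :=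
    ((hA.differentiable (by simp) (t • x)).hasFDerivAt).comp x e1
  have e3 : HasFDerivAt (fun y : E => S (t • y)) _ x :=
    ((hS.differentiable (by simp) (t • x)).hasFDerivAt).comp x e1
  have e4 := (e2.clm_apply (hasFDerivAt_id x)).clm_apply e3
  have e5 : HasFDerivAt (fun y => picF A S (y, t))
      ((fderiv ℝ (picF A S) (x, t)).comp (ContinuousLinearMap.inl ℝ E ℝ)) x :=
    HasFDerivAt.comp (g := picF A S) x ((hF.differentiable (by simp) (x, t)).hasFDerivAt)
      (hasFDerivAt_prodMk_left x t)
  have e6 := e5.unique e4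
  have e7 := DFunLike.congr_fun e6 v
  rw [e7]
  simp
  abel

theorem ray_ftc (hA : ContDiff ℝ 1 A) {S : E → T} (hS : ContDiff ℝ 1 S) (x v : E) :
    A x v (S x) = ∫ t in (0:ℝ)..1,
      (t • fderiv ℝ A (t • x) x v (S (t • x)) + A (t • x) v (S (t • x))
        + t • A (t • x) v (fderiv ℝ S (t • x) x)) := by
  have hd : ∀ t : ℝ, HasDerivAt (fun t : ℝ => t • A (t • x) v (S (t • x)))
      (t • fderiv ℝ A (t • x) x v (S (t • x)) + A (t • x) v (S (t • x))
        + t • A (t • x) v (fderiv ℝ S (t • x) x)) t := by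
    intro t
    have e1 : HasDerivAt (fun t : ℝ => t • x) x t := by
      simpa using (hasDerivAt_id t).smul_const x
    have e2 : HasDerivAt (fun t : ℝ => A (t • x)) (fderiv ℝ A (t • x) x) t :=
      HasFDerivAt.comp_hasDerivAt (l := A) t
        ((hA.differentiable (by simp) (t • x)).hasFDerivAt) e1
    have e3 : HasDerivAt (fun t : ℝ => S (t • x)) (fderiv ℝ S (t • x) x) t :=
      HasFDerivAt.comp_hasDerivAt (l := S) t
        ((hS.differentiable (by simp) (t • x)).hasFDerivAt) e1
    have e4 := (hasDerivAt_id t).smul ((e2.clm_apply (hasDerivAt_const t v)).clm_apply e3)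
    refine e4.congr_deriv ?_
    simp
    abel
  have hcA := hA.continuous
  have hcS := hS.continuous
  have hdA := hA.continuous_fderiv (by simp)
  have hdS := hS.continuous_fderiv (by simp)
  have := intervalIntegral.integral_eq_sub_of_hasDerivAt (a := 0) (b := 1) (fun t _ => hd t)
    (Continuous.intervalIntegrable (by fun_prop) _ _)
  rw [this]
  simp

theorem pic_err (hA : ContDiff ℝ 1 A) (y0 : T) {S : E → T} (hS : ContDiff ℝ 1 S) {r M e : ℝ}
    (hM0 : 0 ≤ M) (he0 : 0 ≤ e) (hMr : M * r ≤ 1 / 4)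
    (hM : ∀ x ∈ Metric.ball (0:E) r, ‖A x‖ ≤ M)
    (hflat : ∀ x ∈ Metric.ball (0:E) r, ∀ v w y,
      fderiv ℝ A x v w y + A x w (A x v y) = fderiv ℝ A x w v y + A x v (A x w y))
    (he : ∀ x ∈ Metric.ball (0:E) r, ∀ v, ‖fderiv ℝ S x v - A x v (S x)‖ ≤ e * ‖v‖)
    {x : E} (hx : x ∈ Metric.ball (0:E) r) (v : E) :
    ‖fderiv ℝ (pic A y0 S) x v - A x v (S x)‖ ≤ 1 / 2 * e * ‖v‖ := by
  have hcA := hA.continuous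
  have hcS := hS.continuous
  have hdA := hA.continuous_fderiv (by simp)
  have hdS := hS.continuous_fderiv (by simp)
  rw [pic_fderiv hA y0 hS, ray_ftc hA hS, ← intervalIntegral.integral_sub
    (Continuous.intervalIntegrable (by fun_prop) _ _)
    (Continuous.intervalIntegrable (by fun_prop) _ _)]
  have hxr : ‖x‖ < r := by simpa using hx
  have := intervalIntegral.norm_integral_le_of_norm_le_const (a := (0:ℝ)) (b := 1)
    (C := 1 / 2 * e * ‖v‖) (f := fun t : ℝ =>
      (t • fderiv ℝ A (t • x) v x (S (t • x)) + A (t • x) v (S (t • x))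
        + t • A (t • x) x (fderiv ℝ S (t • x) v)) -
      (t • fderiv ℝ A (t • x) x v (S (t • x)) + A (t • x) v (S (t • x))
        + t • A (t • x) v (fderiv ℝ S (t • x) x))) ?_
  · simpa using this
  intro t ht
  rw [uIoc_of_le zero_le_one] at ht
  have hz : t • x ∈ Metric.ball (0:E) r := by
    rw [mem_ball_zero_iff, norm_smul, Real.norm_of_nonneg ht.1.le]
    nlinarith [norm_nonneg x, ht.1, ht.2]
  set z := t • x with hzd
  have fl := hflat z hz v x (S z)
  have key : (t • fderiv ℝ A z v x (S z) + A z v (S z) + t • A z x (fderiv ℝ S z v)) -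
      (t • fderiv ℝ A z x v (S z) + A z v (S z) + t • A z v (fderiv ℝ S z x))
      = t • (A z x (fderiv ℝ S z v - A z v (S z)) - A z v (fderiv ℝ S z x - A z x (S z))) := by
    rw [← eq_sub_iff_add_eq] at fl
    rw [fl, map_sub, map_sub]
    module
  rw [key, norm_smul, Real.norm_of_nonneg ht.1.le]
  have b0 : ∀ a b : E, ‖A z a (fderiv ℝ S z b - A z b (S z))‖ ≤ M * ‖a‖ * (e * ‖b‖) := by
    intro a b
    calc _ ≤ ‖A z a‖ * ‖fderiv ℝ S z b - A z b (S z)‖ := (A z a).le_opNorm _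
      _ ≤ (‖A z‖ * ‖a‖) * (e * ‖b‖) := by
        gcongr
        · exact (A z).le_opNorm _
        · exact he z hz b
      _ ≤ _ := by gcongr; exact hM z hz
  have b1 := b0 x v
  have b2 := b0 v x
  have b3 := norm_sub_le (A z x (fderiv ℝ S z v - A z v (S z)))
    (A z v (fderiv ℝ S z x - A z x (S z)))
  have b4 : M * ‖x‖ ≤ 1 / 4 := le_trans (by gcongr) hMr
  have b5 : M * ‖x‖ * (e * ‖v‖) ≤ 1 / 4 * (e * ‖v‖) := by gcongr
  have b6 : M * ‖v‖ * (e * ‖x‖) = M * ‖x‖ * (e * ‖v‖) := by ring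
  calc _ ≤ 1 * ‖A z x (fderiv ℝ S z v - A z v (S z)) - A z v (fderiv ℝ S z x - A z x (S z))‖ := by
        gcongr; exact ht.2
    _ ≤ _ := by linarith

end frob
end Aux
end Loc
end

set_option linter.unusedSectionVars false
noncomputable section
namespace Loc
namespace Aux
open Filter Topology Set

section frob2
variable {E T : Type*} [NormedAddCommGroup E] [NormedSpace ℝ E] [FiniteDimensional ℝ E]
  [NormedAddCommGroup T] [NormedSpace ℝ T] [CompleteSpace T]

variable (A : E → E →L[ℝ] T →L[ℝ] T)

def picN (y0 : T) : ℕ → E → T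
  | 0 => fun _ => y0
  | k + 1 => pic A y0 (picN y0 k)

variable {A}

theorem picN_contDiff (hA : ContDiff ℝ 1 A) (y0 : T) (k : ℕ) : ContDiff ℝ 1 (picN A y0 k) := by
  induction k with
  | zero => exact contDiff_const
  | succ k ih => exact pic_contDiff hA y0 ih

theorem pic_diff (hA : ContDiff ℝ 1 A) (y0 : T) {S S' : E → T} (hS : Continuous S)
    (hS' : Continuous S') {r M e : ℝ}
    (hM0 : 0 ≤ M) (he0 : 0 ≤ e) (hMr : M * r ≤ 1 / 4)
    (hM : ∀ x ∈ Metric.ball (0:E) r, ‖A x‖ ≤ M)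
    (he : ∀ x ∈ Metric.ball (0:E) r, ‖S x - S' x‖ ≤ e)
    {x : E} (hx : x ∈ Metric.ball (0:E) r) :
    ‖pic A y0 S x - pic A y0 S' x‖ ≤ 1 / 4 * e := by
  have hcA := hA.continuous
  unfold pic
  rw [add_sub_add_left_eq_sub, ← intervalIntegral.integral_sub
    (Continuous.intervalIntegrable (by fun_prop) _ _)
    (Continuous.intervalIntegrable (by fun_prop) _ _)]
  have hxr : ‖x‖ < r := by simpa using hx
  have := intervalIntegral.norm_integral_le_of_norm_le_const (a := (0:ℝ)) (b := 1)
    (C := 1 / 4 * e) (f := fun t : ℝ => A (t • x) x (S (t • x)) - A (t • x) x (S' (t • x))) ?_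
  · simpa using this
  intro t ht
  rw [uIoc_of_le zero_le_one] at ht
  have hz : t • x ∈ Metric.ball (0:E) r := by
    rw [mem_ball_zero_iff, norm_smul, Real.norm_of_nonneg ht.1.le]
    nlinarith [norm_nonneg x, ht.1, ht.2]
  rw [← map_sub]
  calc _ ≤ ‖A (t • x) x‖ * ‖S (t • x) - S' (t • x)‖ := (A (t • x) x).le_opNorm _
      _ ≤ (‖A (t • x)‖ * ‖x‖) * e := by
        gcongr
        · exact (A (t • x)).le_opNorm _
        · exact he _ hz
      _ ≤ (M * r) * e := by gcongr; exact hM _ hz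
      _ ≤ _ := by gcongr

theorem frob_ball (hA : ContDiff ℝ 1 A) (y0 : T) {r M : ℝ} (hr : 0 < r)
    (hM0 : 0 ≤ M) (hMr : M * r ≤ 1 / 4)
    (hM : ∀ x ∈ Metric.ball (0:E) r, ‖A x‖ ≤ M)
    (hflat : ∀ x ∈ Metric.ball (0:E) r, ∀ v w y,
      fderiv ℝ A x v w y + A x w (A x v y) = fderiv ℝ A x w v y + A x v (A x w y)) :
    ∃ S : E → T, S 0 = y0 ∧
      ∀ x ∈ Metric.ball (0:E) r, HasFDerivAt S ((A x).flip (S x)) x := by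
  set P := picN A y0 with hP
  have hsm := picN_contDiff hA y0
  have hdiff : ∀ k, ∀ x ∈ Metric.ball (0:E) r, ‖P (k + 1) x - P k x‖ ≤ ‖y0‖ * (1 / 2) ^ k := by
    intro k
    induction k with
    | zero =>
      intro x hx
      have h0 : ‖pic A y0 (fun _ => y0) x - pic A y0 (fun _ => 0) x‖ ≤ 1 / 4 * ‖y0‖ :=
        pic_diff hA y0 continuous_const continuous_const hM0 (norm_nonneg y0) hMr hM
          (fun _ _ => by simp) hx
      have h1 : pic A y0 (fun _ => 0) x = y0 := by simp [pic]
      rw [h1] at h0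
      have h2 : P (0 + 1) x - P 0 x = pic A y0 (fun _ => y0) x - y0 := rfl
      rw [h2]
      have := norm_nonneg y0
      simp only [pow_zero, mul_one]
      linarith
    | succ k ih =>
      intro x hx
      have h0 := pic_diff hA y0 (hsm (k + 1)).continuous (hsm k).continuous hM0
        (by positivity) hMr hM ih hx
      refine le_trans h0 ?_
      have : 0 ≤ ‖y0‖ * (1 / 2) ^ k := by positivity
      rw [pow_succ]
      linarith
  have herr : ∀ k, ∀ x ∈ Metric.ball (0:E) r, ∀ v,
      ‖fderiv ℝ (P k) x v - A x v (P k x)‖ ≤ 4 * (M * ‖y0‖) * (3 / 4) ^ k * ‖v‖ := by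
    intro k
    induction k with
    | zero =>
      intro x hx v
      have h1 : fderiv ℝ (P 0) x = 0 := fderiv_const_apply y0
      have h2 : P 0 x = y0 := rfl
      rw [h1, h2]
      have h3 : ‖A x v y0‖ ≤ M * ‖v‖ * ‖y0‖ :=
        calc _ ≤ ‖A x v‖ * ‖y0‖ := (A x v).le_opNorm _
          _ ≤ ‖A x‖ * ‖v‖ * ‖y0‖ := by gcongr; exact (A x).le_opNorm _
          _ ≤ _ := by gcongr; exact hM x hx
      have : 0 ≤ M * ‖v‖ * ‖y0‖ := by positivity
      simp only [zero_apply, zero_sub, norm_neg, pow_zero]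
      linarith
    | succ k ih =>
      intro x hx v
      have h1 := pic_err hA y0 (hsm k) hM0 (e := 4 * (M * ‖y0‖) * (3 / 4) ^ k) (by positivity)
        hMr hM hflat ih hx v
      have h2 : ‖A x v (P (k + 1) x - P k x)‖ ≤ M * ‖v‖ * (‖y0‖ * (1 / 2) ^ k) :=
        calc _ ≤ ‖A x v‖ * ‖P (k + 1) x - P k x‖ := (A x v).le_opNorm _
          _ ≤ ‖A x‖ * ‖v‖ * (‖y0‖ * (1 / 2) ^ k) := by
            gcongr
            · exact (A x).le_opNorm _
            · exact hdiff k x hx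
          _ ≤ _ := by gcongr; exact hM x hx
      have h3 : M * ‖v‖ * (‖y0‖ * (1 / 2) ^ k) ≤ M * ‖v‖ * (‖y0‖ * (3 / 4) ^ k) := by
        have : (1 / 2 : ℝ) ^ k ≤ (3 / 4) ^ k := pow_le_pow_left₀ (by norm_num) (by norm_num) k
        gcongr
      have h4 : fderiv ℝ (P (k + 1)) x v - A x v (P (k + 1) x)
          = (fderiv ℝ (pic A y0 (picN A y0 k)) x v - A x v (picN A y0 k x))
            - A x v (P (k + 1) x - P k x) := by
        rw [map_sub]
        show fderiv ℝ (pic A y0 (picN A y0 k)) x v - A x v (P (k + 1) x) = _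
        rw [hP]; abel
      rw [h4]
      refine (norm_sub_le _ _).trans ?_
      rw [pow_succ]
      nlinarith
  have hcau : ∀ x ∈ Metric.ball (0:E) r, ∀ k, dist (P k x) (P (k + 1) x) ≤ ‖y0‖ * (1 / 2) ^ k := by
    intro x hx k
    rw [dist_comm, dist_eq_norm]
    exact hdiff k x hx
  have hlim : ∀ x ∈ Metric.ball (0:E) r, ∃ l, Tendsto (fun k => P k x) atTop (𝓝 l) := fun x hx =>
    cauchySeq_tendsto_of_complete (cauchySeq_of_le_geometric _ _ (by norm_num) (hcau x hx))
  choose! S hS using hlim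
  have hrate : ∀ x ∈ Metric.ball (0:E) r, ∀ k, ‖P k x - S x‖ ≤ 2 * ‖y0‖ * (1 / 2) ^ k := by
    intro x hx k
    have := dist_le_of_le_geometric_of_tendsto _ _ (by norm_num) (hcau x hx) (hS x hx) k
    rw [dist_eq_norm] at this
    refine this.trans (le_of_eq ?_)
    ring
  refine ⟨S, ?_, fun x hx => ?_⟩
  · have h0 : ∀ k, P k 0 = y0 := by
      intro k
      cases k with
      | zero => rfl
      | succ k => show pic A y0 _ 0 = y0; simp [pic]
    refine tendsto_nhds_unique (hS 0 (by simpa using hr)) ?_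
    simp only [h0]
    exact tendsto_const_nhds
  · refine hasFDerivAt_of_tendstoUniformlyOn (f := P) (f' := fun k x => fderiv ℝ (P k) x)
      (g' := fun x => (A x).flip (S x)) (l := atTop) Metric.isOpen_ball ?_ ?_ hS hx
    · rw [Metric.tendstoUniformlyOn_iff]
      intro ε hε
      have hz : Tendsto (fun k : ℕ => 4 * (M * ‖y0‖) * (3 / 4 : ℝ) ^ k
          + M * (2 * ‖y0‖ * (1 / 2 : ℝ) ^ k)) atTop (𝓝 0) := by
        have h1 := (tendsto_pow_atTop_nhds_zero_of_lt_one (r := (3 / 4 : ℝ)) (by norm_num)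
          (by norm_num)).const_mul (4 * (M * ‖y0‖))
        have h2 := ((tendsto_pow_atTop_nhds_zero_of_lt_one (r := (1 / 2 : ℝ)) (by norm_num)
          (by norm_num)).const_mul (2 * ‖y0‖)).const_mul M
        simpa using h1.add h2
      filter_upwards [hz.eventually (gt_mem_nhds hε)] with k hk x hx
      refine lt_of_le_of_lt ?_ hk
      rw [dist_comm, dist_eq_norm]
      refine ContinuousLinearMap.opNorm_le_bound _ (by positivity) fun v => ?_
      have e : (fderiv ℝ (P k) x - (A x).flip (S x)) v
          = (fderiv ℝ (P k) x v - A x v (P k x)) + A x v (P k x - S x) := by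
        rw [map_sub]; simp
      rw [e]
      have h2 : ‖A x v (P k x - S x)‖ ≤ M * ‖v‖ * (2 * ‖y0‖ * (1 / 2) ^ k) :=
        calc _ ≤ ‖A x v‖ * ‖P k x - S x‖ := (A x v).le_opNorm _
          _ ≤ ‖A x‖ * ‖v‖ * (2 * ‖y0‖ * (1 / 2) ^ k) := by
            gcongr
            · exact (A x).le_opNorm _
            · exact hrate x hx k
          _ ≤ _ := by gcongr; exact hM x hx
      refine (norm_add_le _ _).trans ?_
      have h3 := herr k x hx v
      linarith
    · intro k x _
      exact ((hsm k).differentiable (by simp) x).hasFDerivAt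

theorem frob_smooth {B : Set E} (hB : IsOpen B) (hA : ContDiffOn ℝ (⊤ : ℕ∞) A B) {S : E → T}
    (hS : ∀ x ∈ B, HasFDerivAt S ((A x).flip (S x)) x) : ContDiffOn ℝ (⊤ : ℕ∞) S B := by
  rw [contDiffOn_infty]
  intro k
  induction k with
  | zero =>
    rw [Nat.cast_zero, contDiffOn_zero]
    exact fun x hx => (hS x hx).continuousAt.continuousWithinAt
  | succ k ih =>
    push_cast
    rw [contDiffOn_succ_iff_fderiv_of_isOpen hB]
    refine ⟨fun x hx => (hS x hx).differentiableAt.differentiableWithinAt, by simp, ?_⟩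
    have : ContDiffOn ℝ k (fun x => (A x).flip (S x)) B := by
      rw [contDiffOn_clm_apply]
      intro v
      exact ((contDiffOn_infty.1 hA k).clm_apply contDiffOn_const).clm_apply ih
    exact this.congr fun x hx => (hS x hx).fderiv

end frob2
end Aux
end Loc
end

set_option linter.unusedSectionVars false
noncomputable section
namespace Loc
namespace Aux
open Filter Topology Set

section frob3
variable {n : ℕ} {E : Type*} [NormedAddCommGroup E] [NormedSpace ℝ E] [FiniteDimensional ℝ E]
  (b : Module.Basis (Fin n) ℝ E) {T : Type*} [NormedAddCommGroup T] [NormedSpace ℝ T] [FiniteDimensional ℝ T]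

/-- the connection form assembled from its coefficients -/
def asm (W : Fin n → E → T →ₗ[ℝ] T) (x : E) : E →L[ℝ] T →L[ℝ] T :=
  ∑ i, (LinearMap.toContinuousLinearMap (b.coord i)).smulRight
    (LinearMap.toContinuousLinearMap (W i x))

theorem asm_apply (W : Fin n → E → T →ₗ[ℝ] T) (x v : E) (y : T) :
    asm b W x v y = ∑ i, b.repr v i • W i x y := by
  simp [asm]

theorem asm_smooth {W : Fin n → E → T →ₗ[ℝ] T} {U : Set (E)}
    (hW : ∀ i y, ContDiffOn ℝ (⊤ : ℕ∞) (fun q => W i q y) U) : ContDiffOn ℝ (⊤ : ℕ∞) (asm b W) U := by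
  rw [contDiffOn_clm_apply]
  intro v
  rw [contDiffOn_clm_apply]
  intro y
  simp only [asm_apply]
  exact ContDiffOn.sum fun i _ => contDiffOn_const.smul (hW i y)

theorem cutoff {F : Type*} [NormedAddCommGroup F] [NormedSpace ℝ F] {U : Set E} (hU : IsOpen U)
    {f : E → F} (hf : ContDiffOn ℝ (⊤ : ℕ∞) f U) {R : ℝ} (hR : 0 < R)
    (hRU : Metric.ball (0 : E) R ⊆ U) :
    ∃ A : E → F, ContDiff ℝ (⊤ : ℕ∞) A ∧ (∀ x ∈ Metric.ball (0 : E) (R / 4), A x = f x) ∧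
      ∃ B, 0 ≤ B ∧ ∀ x ∈ Metric.closedBall (0 : E) (R / 4), ‖A x‖ ≤ B := by
  let χ : ContDiffBump (0 : E) := ⟨R / 4, R / 2, by positivity, by linarith⟩
  have hA : ContDiff ℝ (⊤ : ℕ∞) (fun x => χ x • f x) := by
    rw [contDiff_iff_contDiffAt]
    intro x
    by_cases h1 : x ∈ tsupport χ
    swap
    · have h3 : χ =ᶠ[𝓝 x] 0 := notMem_tsupport_iff_eventuallyEq.1 h1
      have h4 : (fun x => χ x • f x) =ᶠ[𝓝 x] fun _ => 0 := by
        filter_upwards [h3] with q hq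
        simp [hq]
      exact contDiffAt_const.congr_of_eventuallyEq h4
    rw [χ.tsupport_eq] at h1
    have h2 : x ∈ U := hRU (Metric.closedBall_subset_ball (by show R / 2 < R; linarith) h1)
    exact χ.contDiff.contDiffAt.smul (hf.contDiffAt (hU.mem_nhds h2))
  refine ⟨fun x => χ x • f x, hA, fun x hx => ?_, ?_⟩
  · simp only
    rw [χ.one_of_mem_closedBall (Metric.ball_subset_closedBall hx), one_smul]
  · obtain ⟨B, hB⟩ := (isCompact_closedBall (0 : E) (R / 4)).exists_bound_of_continuousOn
      hA.continuous.continuousOn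
    exact ⟨B, (norm_nonneg _).trans (hB 0 (by simp; linarith)), hB⟩

theorem frob0 (W : Fin n → E → T →ₗ[ℝ] T) {U : Set (E)} (hU : IsOpen U)
    (hW : ∀ i y, ContDiffOn ℝ (⊤ : ℕ∞) (fun q => W i q y) U)
    (flat : ∀ q ∈ U, ∀ i j y,
      fderiv ℝ (fun q => W j q y) q (b i) + W j q (W i q y)
        = fderiv ℝ (fun q => W i q y) q (b j) + W i q (W j q y))
    (h0 : (0 : E) ∈ U) (y0 : T) :
    ∃ r > 0, Metric.ball (0 : E) r ⊆ U ∧ ∃ S : E → T,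
      ContDiffOn ℝ (⊤ : ℕ∞) S (Metric.ball 0 r) ∧ S 0 = y0 ∧
      ∀ x ∈ Metric.ball (0 : E) r, ∀ i, fderiv ℝ S x (b i) = W i x (S x) := by
  obtain ⟨R, hR, hRU⟩ := Metric.isOpen_iff.1 hU 0 h0
  have hA0 := asm_smooth b hW
  obtain ⟨A, hA, hAeq, B, hB0, hB⟩ := cutoff hU hA0 hR hRU
  have hin : ∀ x ∈ Metric.ball (0 : E) (R / 4), x ∈ U := fun x hx =>
    hRU (Metric.ball_subset_ball (by linarith) hx)
  set r := min (R / 4) (1 / (4 * (B + 1))) with hr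
  have hr0 : 0 < r := by positivity
  have hBr : B * r ≤ 1 / 4 := by
    calc B * r ≤ (B + 1) * (1 / (4 * (B + 1))) := by
          gcongr
          · linarith
          · exact min_le_right _ _
      _ = 1 / 4 := by field_simp
  have hsub : Metric.ball (0 : E) r ⊆ Metric.ball 0 (R / 4) :=
    Metric.ball_subset_ball (min_le_left _ _)
  have hexp : ∀ (L : E →L[ℝ] T) (v : E), L v = ∑ i, b.repr v i • L (b i) := by
    intro L v
    have := congrArg L (b.sum_repr v)
    rw [map_sum] at this
    rw [← this]
    exact Finset.sum_congr rfl fun i _ => (map_smul L _ _)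
  have hd : ∀ x ∈ Metric.ball (0 : E) r, ∀ v w y, fderiv ℝ A x v w y
      = ∑ i, ∑ j, (b.repr v i * b.repr w j) • fderiv ℝ (fun q => W j q y) x (b i) := by
    intro x hx v w y
    have e1 : HasFDerivAt (fun q => A q w y) (((fderiv ℝ A x).flip w).flip y) x := by
      have := (((hA.differentiable (by simp) x).hasFDerivAt).clm_apply
        (hasFDerivAt_const w x)).clm_apply (hasFDerivAt_const y x)
      convert this using 1
      ext v
      simp
    have e2 : HasFDerivAt (fun q => ∑ j, b.repr w j • W j q y)
        (∑ j, b.repr w j • fderiv ℝ (fun q => W j q y) x) x := by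
      refine HasFDerivAt.fun_sum fun j _ => ?_
      refine HasFDerivAt.const_smul ?_ _
      exact (((hW j y).contDiffAt (hU.mem_nhds (hin x (hsub hx)))).differentiableAt
        (by simp)).hasFDerivAt
    have e3 : (fun q => A q w y) =ᶠ[𝓝 x] (fun q => ∑ j, b.repr w j • W j q y) := by
      filter_upwards [Metric.isOpen_ball.mem_nhds (hsub hx)] with q hq
      rw [hAeq q hq, asm_apply]
    have e4 := e1.unique (e2.congr_of_eventuallyEq e3)
    have e5 := DFunLike.congr_fun e4 v
    have e6 : fderiv ℝ A x v w y = (((fderiv ℝ A x).flip w).flip y) v := by simp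
    rw [e6, e5, hexp]
    refine Finset.sum_congr rfl fun i _ => ?_
    simp [Finset.smul_sum, smul_smul]
  have hflat : ∀ x ∈ Metric.ball (0 : E) r, ∀ v w y,
      fderiv ℝ A x v w y + A x w (A x v y) = fderiv ℝ A x w v y + A x v (A x w y) := by
    intro x hx v w y
    have e1 : ∀ v w, A x w (A x v y) = ∑ i, ∑ j, (b.repr v i * b.repr w j) • W j x (W i x y) := by
      intro v w
      rw [hAeq x (hsub hx), asm_apply, asm_apply, Finset.sum_comm]
      simp [Finset.smul_sum, smul_smul, mul_comm]
    rw [hd x hx, hd x hx, e1, e1, ← Finset.sum_add_distrib, ← Finset.sum_add_distrib,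
      Finset.sum_congr rfl fun i _ => (Finset.sum_add_distrib).symm,
      Finset.sum_congr (s₁ := Finset.univ) (g := fun i => ∑ j, ((b.repr w i * b.repr v j) •
        fderiv ℝ (fun q => W j q y) x (b i) + (b.repr w i * b.repr v j) • W j x (W i x y))) rfl
        fun i _ => (Finset.sum_add_distrib).symm]
    rw [Finset.sum_comm]
    refine Finset.sum_congr rfl fun i _ => Finset.sum_congr rfl fun j _ => ?_
    rw [← smul_add, ← smul_add, flat x (hin x (hsub hx)), mul_comm]
  obtain ⟨S, hS0, hS⟩ := frob_ball (hA.of_le (by norm_cast)) y0 hr0 hB0 hBr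
    (fun x hx => hB x (Metric.ball_subset_closedBall (hsub hx))) hflat
  refine ⟨r, hr0, fun x hx => hin x (hsub hx), S, frob_smooth Metric.isOpen_ball hA.contDiffOn hS,
    hS0, fun x hx i => ?_⟩
  rw [(hS x hx).fderiv, ContinuousLinearMap.flip_apply, hAeq x (hsub hx), asm_apply]
  simp [Finsupp.single_apply]

theorem frob (W : Fin n → Pt n → T →ₗ[ℝ] T) {U : Set (Pt n)} (hU : IsOpen U)
    (hW : ∀ i y, ContDiffOn ℝ (⊤ : ℕ∞) (fun q => W i q y) U)
    (flat : ∀ q ∈ U, ∀ i j y,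
      fderiv ℝ (fun q => W j q y) q (Pi.single i 1) + W j q (W i q y)
        = fderiv ℝ (fun q => W i q y) q (Pi.single j 1) + W i q (W j q y))
    {p : Pt n} (hp : p ∈ U) (y0 : T) :
    ∃ r > 0, Metric.ball p r ⊆ U ∧ ∃ S : Pt n → T,
      ContDiffOn ℝ (⊤ : ℕ∞) S (Metric.ball p r) ∧ S p = y0 ∧
      ∀ x ∈ Metric.ball p r, ∀ i, fderiv ℝ S x (Pi.single i 1) = W i x (S x) := by
  have hsm : ContDiff ℝ (⊤ : ℕ∞) fun x : Pt n => x + p := contDiff_id.add contDiff_const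
  obtain ⟨r, hr, hrU, S, hS, hS0, hS'⟩ := frob0 (Pi.basisFun ℝ (Fin n)) (fun i x => W i (x + p))
    (U := (fun x => x + p) ⁻¹' U) (hU.preimage hsm.continuous)
    (fun i y => (hW i y).comp hsm.contDiffOn fun x hx => hx)
    (fun q hq i j y => by
      have := flat (q + p) hq i j y
      rw [fderiv_comp_add_right (f := fun q => W j q y),
        fderiv_comp_add_right (f := fun q => W i q y)]
      simpa only [Pi.basisFun_apply] using this) (by simpa using hp) y0
  simp only [Pi.basisFun_apply] at hS'
  have hm : ∀ x ∈ Metric.ball p r, x - p ∈ Metric.ball (0 : Pt n) r := by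
    intro x hx
    rw [mem_ball_zero_iff, ← dist_eq_norm]; exact hx
  refine ⟨r, hr, fun x hx => ?_, fun x => S (x - p), ?_, by simpa using hS0, fun x hx i => ?_⟩
  · simpa using hrU (hm x hx)
  · exact hS.comp (contDiff_id.sub contDiff_const).contDiffOn hm
  · rw [fderiv_comp_sub, hS' _ (hm x hx), sub_add_cancel]

end frob3
end Aux
end Loc
end

set_option linter.unusedSectionVars false
noncomputable section
namespace Loc
namespace Aux
open Matrix Filter Topology

variable {n : ℕ}
section
variable {U V : Set (Pt n)} {h φ ψ : Pt n → Mat n} {ω : Fin n → Pt n → Mat n}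

theorem Conn.mono (H : Conn U h ω) (hV : IsOpen V) (hs : V ⊆ U) : Conn V h ω :=
  ⟨hV, fun p hp => H.smh p (hs hp), fun p hp => H.symm p (hs hp), fun p hp => H.posdef p (hs hp),
    fun p hp => H.smw p (hs hp), fun p hp => H.met p (hs hp)⟩

theorem Coh.mono (C : Coh U ω φ) (hs : V ⊆ U) : Coh V ω φ :=
  ⟨fun p hp => C.sm p (hs hp), fun p hp => C.coh p (hs hp)⟩

/-- a dual pair of coherent homomorphisms -/
structure DP (U : Set (Pt n)) (h : Pt n → Mat n) (ω : Fin n → Pt n → Mat n)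
    (φ ψ : Pt n → Mat n) : Prop where
  H : Conn U h ω
  C : Coh U ω φ
  C' : Coh U ω ψ
  curv : ∀ p ∈ U, ∀ i j, Om ω i j p = wedge (h p) (cl φ i p) (cl ψ j p)
    - wedge (h p) (cl φ j p) (cl ψ i p)
  sym : ∀ p ∈ U, ∀ i j, ip (h p) (cl φ i p) (cl ψ j p) = ip (h p) (cl φ j p) (cl ψ i p)

theorem DP.swap (P : DP U h ω φ ψ) : DP U h ω ψ φ := by
  refine ⟨P.H, P.C', P.C, fun p hp i j => ?_, fun p hp i j => ?_⟩
  · rw [P.curv p hp, wedge_swap (h p) (cl ψ i p), wedge_swap (h p) (cl ψ j p)]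
    abel
  · rw [ip_comm (P.H.symm p hp), P.sym p hp, ip_comm (P.H.symm p hp)]

/-- fibre of the tractor bundle -/
abbrev Tr (n : ℕ) := ℝ × (Fin n → ℝ) × ℝ

/-- tractor connection coefficients -/
def TW (h φ ψ : Pt n → Mat n) (ω : Fin n → Pt n → Mat n) (i : Fin n) (q : Pt n) :
    Tr n →ₗ[ℝ] Tr n where
  toFun y := (ip (h q) (cl φ i q) y.2.1,
    -(ω i q *ᵥ y.2.1) - y.1 • cl ψ i q + y.2.2 • cl φ i q, -ip (h q) (cl ψ i q) y.2.1)
  map_add' x y := by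
    refine Prod.ext ?_ (Prod.ext ?_ ?_)
    · simp [ip_add_right]
    · simp only [Prod.fst_add, Prod.snd_add, mulVec_add]; module
    · simp [ip_add_right]; ring
  map_smul' r y := by
    refine Prod.ext ?_ (Prod.ext ?_ ?_)
    · simp [ip_smul_right]
    · simp only [Prod.smul_fst, Prod.smul_snd, mulVec_smul, RingHom.id_apply, smul_eq_mul]; module
    · simp [ip_smul_right]

theorem fderiv_tr {f : Pt n → ℝ} {s : Pt n → Fin n → ℝ} {g : Pt n → ℝ} {q : Pt n}
    (hf : Sm f q) (hs : SmV s q) (hg : Sm g q) (i : Fin n) :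
    fderiv ℝ (fun x => ((f x, s x, g x) : Tr n)) q (Pi.single i 1)
      = (pd i f q, pdV i s q, pd i g q) := by
  have h2 : HasFDerivAt s (ContinuousLinearMap.pi fun a => fderiv ℝ (fun x => s x a) q) q :=
    hasFDerivAt_pi.2 fun a => (hs a).da.hasFDerivAt
  rw [(hf.da.hasFDerivAt.prodMk (h2.prodMk hg.da.hasFDerivAt)).fderiv]
  rfl

theorem sm_const (c : ℝ) (q : Pt n) : Sm (fun _ => c) q := contDiffAt_const
theorem smV_const (c : Fin n → ℝ) (q : Pt n) : SmV (fun _ => c) q := fun _ => contDiffAt_const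
theorem pd_const (i : Fin n) (c : ℝ) (q : Pt n) : pd i (fun _ => c) q = 0 := by simp [pd]
theorem pdV_const (i : Fin n) (c : Fin n → ℝ) (q : Pt n) : pdV i (fun _ => c) q = 0 := by
  ext a; simp [pdV, pd]
theorem DV_const (i : Fin n) (c : Fin n → ℝ) (q : Pt n) :
    DV ω i (fun _ => c) q = ω i q *ᵥ c := by
  simp [DV, pdV_const]

theorem Sm.neg {f : Pt n → ℝ} {q : Pt n} (hf : Sm f q) : Sm (fun x => - f x) q :=
  ContDiffAt.neg hf
theorem SmV.neg {s : Pt n → Fin n → ℝ} {q : Pt n} (hs : SmV s q) : SmV (fun x => - s x) q :=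
  fun a => ContDiffAt.neg (hs a)
theorem pd_neg (i : Fin n) {f : Pt n → ℝ} {q : Pt n} :
    pd i (fun x => - f x) q = - pd i f q := by
  unfold pd
  rw [fderiv_fun_neg]; rfl
theorem pdV_neg (i : Fin n) {s : Pt n → Fin n → ℝ} {q : Pt n} :
    pdV i (fun x => - s x) q = - pdV i s q := by
  ext a; exact pd_neg i

theorem TW_flat (P : DP U h ω φ ψ) {q : Pt n} (hq : q ∈ U) (i j : Fin n) (y : Tr n) :
    fderiv ℝ (fun q => TW h φ ψ ω j q y) q (Pi.single i 1) + TW h φ ψ ω j q (TW h φ ψ ω i q y)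
      = fderiv ℝ (fun q => TW h φ ψ ω i q y) q (Pi.single j 1)
        + TW h φ ψ ω i q (TW h φ ψ ω j q y) := by
  obtain ⟨f, ξ, l⟩ := y
  have H := P.H
  have hh := H.smh q hq
  have key : ∀ i j, fderiv ℝ (fun q => TW h φ ψ ω j q (f, ξ, l)) q (Pi.single i 1)
      = (ip (h q) (DV ω i (cl φ j) q) ξ + ip (h q) (cl φ j q) (ω i q *ᵥ ξ),
        -(pdM i (ω j) q *ᵥ ξ) - f • pdV i (cl ψ j) q + l • pdV i (cl φ j) q,
        -(ip (h q) (DV ω i (cl ψ j) q) ξ + ip (h q) (cl ψ j q) (ω i q *ᵥ ξ))) := by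
    intro i j
    have c1 := P.C.smc hq j
    have c2 := P.C'.smc hq j
    have cx := smV_const ξ q
    have w := (H.smw q hq j).mulVec cx
    have a1 := SmV.ip hh c1 cx
    have a3 := SmV.ip hh c2 cx
    have a2 := SmV.smul (sm_const f q) c2
    have a4 := SmV.smul (sm_const l q) c1
    refine (fderiv_tr a1 ((w.neg.sub a2).add a4) a3.neg i).trans ?_
    refine Prod.ext ?_ (Prod.ext ?_ ?_)
    · show pd i _ q = _
      rw [pd_ip H hq c1 cx, DV_const]
    · show pdV i _ q = _
      rw [pdV_add i (w.neg.sub a2) a4, pdV_sub i w.neg a2, pdV_neg, pdV_mulVec i (H.smw q hq j) cx,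
        pdV_smul i (sm_const _ _) c1, pdV_smul i (sm_const _ _) c2, pd_const, pd_const, pdV_const]
      simp
    · show pd i _ q = _
      rw [pd_neg, pd_ip H hq c2 cx, DV_const]
  rw [key, key]
  have hs := H.symm q hq
  have cp := P.C.coh q hq i j
  have cs := P.C'.coh q hq i j
  refine Prod.ext ?_ (Prod.ext ?_ ?_)
  · simp only [TW, LinearMap.coe_mk, AddHom.coe_mk, Prod.fst_add, ip_add_right, ip_sub_right,
      ip_smul_right, cp]
    have e1 : ∀ a b : Fin n → ℝ, ip (h q) a (-b) = - ip (h q) a b := by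
      intro a b; simpa using ip_smul_right (h q) (-1) b a
    rw [e1, e1, P.sym q hq i j, ip_comm hs (cl φ i q) (cl φ j q)]
    ring
  · have om := congrArg (fun A => A *ᵥ ξ) (P.curv q hq i j)
    simp only [Om, sub_mulVec, add_mulVec, wedge_mulVec hs, ← mulVec_mulVec] at om
    simp only [DV] at cp cs
    simp only [TW, LinearMap.coe_mk, AddHom.coe_mk, Prod.fst_add, Prod.snd_add, mulVec_add,
      mulVec_sub, mulVec_neg, mulVec_smul]
    rw [← sub_eq_zero] at om cp cs ⊢
    have : (0 : Fin n → ℝ) = -1 • (0 : Fin n → ℝ) - f • (0 : Fin n → ℝ) + l • (0 : Fin n → ℝ) := by simp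
    rw [this]
    nth_rewrite 2 [← cs]
    nth_rewrite 2 [← cp]
    nth_rewrite 1 [← om]
    module
  · simp only [TW, LinearMap.coe_mk, AddHom.coe_mk, Prod.fst_add, Prod.snd_add, ip_add_right, ip_sub_right,
      ip_smul_right, cs]
    have e1 : ∀ a b : Fin n → ℝ, ip (h q) a (-b) = - ip (h q) a b := by
      intro a b; simpa using ip_smul_right (h q) (-1) b a
    rw [e1, e1, ip_comm hs (cl ψ j q) (cl φ i q), ip_comm hs (cl ψ i q) (cl φ j q), P.sym q hq i j,
      ip_comm hs (cl ψ i q) (cl ψ j q)]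
    ring

theorem TW_smooth (P : DP U h ω φ ψ) (i : Fin n) (y : Tr n) :
    ContDiffOn ℝ (⊤ : ℕ∞) (fun q => TW h φ ψ ω i q y) U := by
  intro q hq
  apply ContDiffAt.contDiffWithinAt
  have hh := P.H.smh q hq
  have c1 := P.C.smc hq i
  have c2 := P.C'.smc hq i
  have cx := smV_const y.2.1 q
  have w := (P.H.smw q hq i).mulVec cx
  exact (SmV.ip hh c1 cx).prodMk ((contDiffAt_pi.2 ((w.neg.sub
    (SmV.smul (sm_const y.1 q) c2)).add (SmV.smul (sm_const y.2.2 q) c1))).prodMk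
      (SmV.ip hh c2 cx).neg)

theorem tractor (P : DP U h ω φ ψ) {p : Pt n} (hp : p ∈ U) :
    ∃ r > 0, Metric.ball p r ⊆ U ∧ ∃ (f l : Pt n → ℝ) (ξ : Pt n → Fin n → ℝ),
      f p = 1 ∧ l p = 0 ∧ ξ p = 0 ∧ ∀ q ∈ Metric.ball p r, Sm f q ∧ Sm l q ∧ SmV ξ q ∧
        ∀ i, pd i f q = ip (h q) (cl φ i q) (ξ q) ∧ pd i l q = - ip (h q) (cl ψ i q) (ξ q) ∧
          DV ω i ξ q = l q • cl φ i q - f q • cl ψ i q := by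
  obtain ⟨r, hr, hrU, S, hS, hS0, hS'⟩ := frob (TW h φ ψ ω) P.H.op (TW_smooth P)
    (fun q hq i j y => TW_flat P hq i j y) hp ((1, 0, 0) : Tr n)
  refine ⟨r, hr, hrU, fun q => (S q).1, fun q => (S q).2.2, fun q => (S q).2.1, by simp [hS0],
    by simp [hS0], by simp [hS0], fun q hq => ?_⟩
  have sS : ContDiffAt ℝ (⊤ : ℕ∞) S q := hS.contDiffAt (Metric.isOpen_ball.mem_nhds hq)
  have s1 : Sm (fun q => (S q).1) q := sS.fst
  have s3 : Sm (fun q => (S q).2.2) q := sS.snd.snd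
  have s2 : SmV (fun q => (S q).2.1) q := fun a => contDiffAt_pi.1 sS.snd.fst a
  refine ⟨s1, s3, s2, fun i => ?_⟩
  have e := (fderiv_tr s1 s2 s3 i).symm.trans (hS' q hq i)
  refine ⟨congrArg Prod.fst e, congrArg (fun y => y.2.2) e, ?_⟩
  have e2 : pdV i (fun q => (S q).2.1) q = _ := congrArg (fun y => y.2.1) e
  rw [DV, e2]
  simp only [TW, LinearMap.coe_mk, AddHom.coe_mk]
  module

theorem tractor' (P : DP U h ω φ ψ) {p : Pt n} (hp : p ∈ U) :
    ∃ r > 0, Metric.ball p r ⊆ U ∧ ∃ (f l : Pt n → ℝ) (ξ : Pt n → Fin n → ℝ),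
      f p = 1 ∧ ∀ q ∈ Metric.ball p r, Sm f q ∧ SmV ξ q ∧ 2 * l q * f q = ip (h q) (ξ q) (ξ q) ∧
        ∀ i, pd i f q = ip (h q) (cl φ i q) (ξ q) ∧
          DV ω i ξ q = l q • cl φ i q - f q • cl ψ i q := by
  obtain ⟨r, hr, hrU, f, l, ξ, f0, l0, x0, hq⟩ := tractor P hp
  refine ⟨r, hr, hrU, f, l, ξ, f0, fun q hq' => ⟨(hq q hq').1, (hq q hq').2.2.1, ?_,
    fun i => ⟨((hq q hq').2.2.2 i).1, ((hq q hq').2.2.2 i).2.2⟩⟩⟩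
  set c : Pt n → ℝ := fun q => 2 * (l q * f q) - ip (h q) (ξ q) (ξ q) with hc
  have sc : ∀ q ∈ Metric.ball p r, Sm c q := fun q hb => by
    obtain ⟨s1, s2, s3, -⟩ := hq q hb
    exact (contDiffAt_const.mul (s2.mul s1)).sub (SmV.ip (P.H.smh q (hrU hb)) s3 s3)
  have dc : ∀ q ∈ Metric.ball p r, fderiv ℝ c q = 0 := by
    intro q hb
    obtain ⟨s1, s2, s3, e⟩ := hq q hb
    have hU := hrU hb
    have : ∀ i, pd i c q = 0 := by
      intro i
      obtain ⟨e1, e2, e3⟩ := e i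
      have t1 : Sm (fun q => l q * f q) q := s2.mul s1
      have t2 : Sm (fun q => 2 * (l q * f q)) q := contDiffAt_const.mul t1
      rw [hc, pd_sub i t2 (SmV.ip (P.H.smh q hU) s3 s3),
        pd_mul i (sm_const 2 q) t1, pd_mul i s2 s1, pd_ip P.H hU s3 s3, pd_const, e1, e2, e3,
        ip_comm (P.H.symm q hU) (ξ q)]
      simp only [ip_sub_left, ip_smul_left]
      ring
    have h2 : (fderiv ℝ c q).toLinearMap = (0 : Pt n →L[ℝ] ℝ).toLinearMap := by
      refine (Pi.basisFun ℝ (Fin n)).ext fun i => ?_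
      simpa [pd] using this i
    exact ContinuousLinearMap.coe_injective h2
  have := Metric.isOpen_ball.is_const_of_fderiv_eq_zero (convex_ball p r).isPreconnected
    (f := c) (𝕜 := ℝ) (fun q hb => (sc q hb).da.differentiableWithinAt) dc (Metric.mem_ball_self hr) hq'
  have c0 : c p = 0 := by simp [hc, l0, x0, ip]
  rw [c0] at this
  simp only [hc] at this
  linarith

theorem DP.cf (P : DP U h ω φ ψ) :
    ConformallyFlatOn (met h φ) {p | p ∈ U ∧ (φ p).det ≠ 0} := by
  rintro p ⟨hp, h0⟩
  obtain ⟨r, hr, hrU, f, l, ξ, f0, hq⟩ := tractor' P hp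
  have hR := reg_open P.H P.C
  set R := {p | p ∈ U ∧ (φ p).det ≠ 0} with hRdef
  have hc : ContinuousOn f (Metric.ball p r) := fun q hb => (hq q hb).1.continuousAt.continuousWithinAt
  have hop := hc.isOpen_inter_preimage Metric.isOpen_ball (isOpen_Ioi (a := (0 : ℝ)))
  set V := (Metric.ball p r ∩ f ⁻¹' Set.Ioi 0) ∩ R with hV
  have hVo : IsOpen V := hop.inter hR
  have hVU : V ⊆ U := fun q hq => hq.2.1
  have H := P.H.mono hVo hVU
  have C := P.C.mono hVU
  have fpos : ∀ q ∈ V, f q ≠ 0 := fun q hq => ne_of_gt hq.1.2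
  have sf : ∀ q ∈ V, Sm f q := fun q hv => (hq q hv.1.1).1
  have sx : ∀ q ∈ V, SmV ξ q := fun q hv => (hq q hv.1.1).2.1
  set σ : Pt n → ℝ := fun q => - Real.log (f q) with hσ
  set g : Pt n → ℝ := fun q => - (f q)⁻¹ with hg
  set u : Pt n → Fin n → ℝ := fun q => g q • ξ q with hu
  have sσ : ∀ q ∈ V, Sm σ q := fun q hv => ((sf q hv).log (fpos q hv)).neg
  have sg : ∀ q ∈ V, Sm g q := fun q hv => (ContDiffAt.inv (sf q hv) (fpos q hv)).neg
  have su : ∀ q ∈ V, SmV u q := fun q hv => SmV.smul (sg q hv) (sx q hv)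
  have e : ∀ q ∈ V, ∀ i, ip (h q) (cl φ i q) (u q) = pd i σ q := by
    intro q hv i
    rw [hu, hσ, pd_neg, ip_smul_right, ← ((hq q hv.1.1).2.2.2 i).1]
    unfold pd
    rw [fderiv.log (sf q hv).da (fpos q hv), hg]
    simp
  have hth : ∀ q ∈ V, ∀ i, th h φ ω u i q = cl ψ i q := by
    intro q hv i
    obtain ⟨-, -, e1, e2⟩ := hq q hv.1.1
    have pg : pd i g q = (f q)⁻¹ ^ 2 * pd i f q := by
      have : HasFDerivAt g _ q := ((hasDerivAt_inv (fpos q hv)).comp_hasFDerivAt q (sf q hv).da.hasFDerivAt).neg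
      unfold pd
      rw [this.fderiv]
      simp
    rw [th, hu]
    simp only
    rw [DV_smul (sg q hv) (sx q hv), pg, (e2 i).1, (e2 i).2, ip_smul_right, ip_smul_left,
      ip_smul_right, ← e1, hg]
    have := fpos q hv
    have a1 : ∀ x : ℝ, x = f q → x ≠ 0 := fun x hx => hx ▸ this
    ext a
    simp only [Pi.add_apply, Pi.sub_apply, Pi.smul_apply, smul_eq_mul]
    field_simp
    ring
  refine ⟨V, hVo, ⟨⟨Metric.mem_ball_self hr, by simp [f0]⟩, hp, h0⟩, fun q hv => hv.2, σ,
    on_of_sm sσ, fun q hv a i j k => ?_⟩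
  rw [← met']
  have Om0 : Om (om' h φ ω u) i j q = 0 := by
    rw [Om' H C su hv, P.curv q (hVU hv), hth q hv, hth q hv]
    abel
  have hd : (Real.exp (σ q) • φ q).det ≠ 0 := by
    rw [det_smul]
    exact mul_ne_zero (pow_ne_zero _ (Real.exp_pos _).ne') hv.2.2
  have := phi_Rm (conn' H C su) (coh' H C sσ su e) hv hd i j
  rw [Om0, Matrix.zero_mul] at this
  have h2 := congrArg (fun A => (Real.exp (σ q) • φ q)⁻¹ * A) this
  simp only [Matrix.mul_zero] at h2
  rw [Matrix.nonsing_inv_mul_cancel_left _ _ hd.isUnit] at h2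
  exact congrFun (congrFun h2 a) k

end
end Aux
end Loc
end

set_option linter.unusedSectionVars false
noncomputable section
namespace Loc
namespace Aux
open Matrix Filter Topology

variable {n : ℕ}
section
variable {U V : Set (Pt n)} {h φ ψ : Pt n → Mat n} {ω : Fin n → Pt n → Mat n}

theorem ip_cl (h φ : Pt n → Mat n) (p : Pt n) (i : Fin n) (v : Fin n → ℝ) :
    ip (h p) (cl φ i p) v = ((φ p)ᵀ *ᵥ (h p *ᵥ v)) i := rfl

theorem local_dual (hn : 3 ≤ n) (H : Conn U h ω) (C : Coh U ω φ)
    (cf : ConformallyFlatOn (met h φ) {p | p ∈ U ∧ (φ p).det ≠ 0})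
    (hψ : ∀ p ∈ {p | p ∈ U ∧ (φ p).det ≠ 0},
      ψ p = φ p * ((met h φ p)⁻¹ * schouten (met h φ) p))
    {p : Pt n} (hp : p ∈ {p | p ∈ U ∧ (φ p).det ≠ 0}) :
    (∀ i j, DV ω i (cl ψ j) p = DV ω j (cl ψ i) p) ∧
    (∀ i j, Om ω i j p = wedge (h p) (cl φ i p) (cl ψ j p) - wedge (h p) (cl φ j p) (cl ψ i p)) ∧
    (∀ i j, ip (h p) (cl φ i p) (cl ψ j p) = ip (h p) (cl φ j p) (cl ψ i p)) := by
  obtain ⟨V, hVo, hpV, hVR, σ, hσ, hflat⟩ := cf p hp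
  have hVU : V ⊆ U := fun q hq => (hVR hq).1
  replace H := H.mono hVo hVU
  replace C := C.mono hVU
  have sσ : ∀ q ∈ V, Sm σ q := fun q hq => sm_of_on hVo hσ hq
  set u : Pt n → Fin n → ℝ := fun q => φ q *ᵥ ((met h φ q)⁻¹ *ᵥ (fun i => pd i σ q)) with hu
  have su : ∀ q ∈ V, SmV u q := fun q hq =>
    (C.sm q hq).mulVec (((met_sm H C hq).inv (met_det H hq (hVR hq).2)).mulVec
      (s := fun q i => pd i σ q) fun i => (sσ q hq).pd i)
  have e : ∀ q ∈ V, ∀ i, ip (h q) (cl φ i q) (u q) = pd i σ q := by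
    intro q hq i
    have e0 : (φ q)ᵀ * h q * φ q = met h φ q := rfl
    rw [ip_cl, hu]
    simp only
    rw [mulVec_mulVec, mulVec_mulVec, mulVec_mulVec, e0,
      Matrix.mul_nonsing_inv _ (met_det H hq (hVR hq).2).isUnit, one_mulVec]
  have hΩ : ∀ q ∈ V, ∀ i j, Om ω i j q = wedge (h q) (cl φ i q) (th h φ ω u j q)
      - wedge (h q) (cl φ j q) (th h φ ω u i q) := by
    intro q hq i j
    have hd : (Real.exp (σ q) • φ q).det ≠ 0 := by
      rw [det_smul]
      exact mul_ne_zero (pow_ne_zero _ (Real.exp_pos _).ne') (hVR hq).2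
    have h1 := phi_Rm (conn' H C su) (coh' H C sσ su e) hq hd i j
    have h2 : Rm (met h (fun q => Real.exp (σ q) • φ q)) i j q = 0 := by
      rw [met']
      ext l k
      exact hflat q hq l i j k
    rw [h2, Matrix.mul_zero] at h1
    have h3 := congrArg (fun A => A * (Real.exp (σ q) • φ q)⁻¹) h1
    simp only [Matrix.zero_mul] at h3
    rw [Matrix.mul_nonsing_inv_cancel_right _ _ hd.isUnit, Om' H C su hq] at h3
    rw [← sub_eq_zero, h3]
    abel
  have hψ' : ∀ q ∈ V, ∀ j, cl ψ j q = th h φ ω u j q := by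
    intro q hq j
    have := phi_Ahat (ψ := fun q => of fun a j => th h φ ω u j q a) hn H C hq (hVR hq).2
      (hΩ q hq) (th_symm H C sσ su e hq)
    rw [← hψ q (hVR hq)] at this
    ext a
    exact congrFun (congrFun this a) j
  refine ⟨fun i j => ?_, fun i j => ?_, fun i j => ?_⟩
  · rw [DV_congr hVo hpV (fun q hq => hψ' q hq j), DV_congr hVo hpV (fun q hq => hψ' q hq i)]
    exact th_coh H C sσ su e hpV i j (hΩ p hpV i j)
  · rw [hψ' p hpV, hψ' p hpV, hΩ p hpV]
  · rw [hψ' p hpV, hψ' p hpV, th_symm H C sσ su e hpV]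

theorem ext_dense {R U : Set (Pt n)} (hRU : R ⊆ U) (hd : U ⊆ closure R) {f g : Pt n → ℝ}
    (hf : ∀ p ∈ U, Sm f p) (hg : ∀ p ∈ U, Sm g p) (h : ∀ p ∈ R, f p = g p) :
    ∀ p ∈ U, f p = g p := by
  have := Set.EqOn.of_subset_closure (s := R) (t := U) (f := f) (g := g) h
    (fun p hp => (hf p hp).continuousAt.continuousWithinAt)
    (fun p hp => (hg p hp).continuousAt.continuousWithinAt) hRU hd
  exact this

theorem Om_sm (H : Conn U h ω) {p : Pt n} (hp : p ∈ U) (i j : Fin n) : SmM (Om ω i j) p :=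
  ((((H.smw p hp j).pdM i).sub ((H.smw p hp i).pdM j)).add
    ((H.smw p hp i).mul (H.smw p hp j))).sub ((H.smw p hp j).mul (H.smw p hp i))

theorem mk_DP (hn : 3 ≤ n) (H : Conn U h ω) (C : Coh U ω φ)
    (hd : U ⊆ closure {p | p ∈ U ∧ (φ p).det ≠ 0})
    (cf : ConformallyFlatOn (met h φ) {p | p ∈ U ∧ (φ p).det ≠ 0})
    (sψ : ∀ p ∈ U, SmM ψ p)
    (hψ : ∀ p ∈ {p | p ∈ U ∧ (φ p).det ≠ 0},
      ψ p = φ p * ((met h φ p)⁻¹ * schouten (met h φ) p)) : DP U h ω φ ψ := by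
  have L := fun p hp => local_dual hn H C cf hψ (p := p) hp
  have sc : ∀ p ∈ U, ∀ j, SmV (cl ψ j) p := fun p hp j a => sψ p hp a j
  have hRU : {p | p ∈ U ∧ (φ p).det ≠ 0} ⊆ U := fun p hp => hp.1
  refine ⟨H, C, ⟨sψ, ?_⟩, ?_, ?_⟩
  · intro p hp i j
    ext a
    exact ext_dense hRU hd (f := fun p => DV ω i (cl ψ j) p a) (g := fun p => DV ω j (cl ψ i) p a)
      (fun p hp => DV_sm H hp (sc p hp j) i a) (fun p hp => DV_sm H hp (sc p hp i) j a)
      (fun p hp => congrFun ((L p hp).1 i j) a) p hp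
  · intro p hp i j
    ext a b
    exact ext_dense hRU hd (f := fun p => Om ω i j p a b)
      (g := fun p => (wedge (h p) (cl φ i p) (cl ψ j p) - wedge (h p) (cl φ j p) (cl ψ i p)) a b)
      (fun p hp => Om_sm H hp i j a b)
      (fun p hp => (SmV.wedge (H.smh p hp) (C.smc hp i) (sc p hp j)).sub
        (SmV.wedge (H.smh p hp) (C.smc hp j) (sc p hp i)) a b)
      (fun p hp => congrFun (congrFun ((L p hp).2.1 i j) a) b) p hp
  · intro p hp i j
    exact ext_dense hRU hd (f := fun p => ip (h p) (cl φ i p) (cl ψ j p))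
      (g := fun p => ip (h p) (cl φ j p) (cl ψ i p))
      (fun p hp => SmV.ip (H.smh p hp) (C.smc hp i) (sc p hp j))
      (fun p hp => SmV.ip (H.smh p hp) (C.smc hp j) (sc p hp i))
      (fun p hp => (L p hp).2.2 i j) p hp

end
end Aux
end Loc

end

open Loc
open Loc.Aux

/-- Theorem: the duality is an involution: let `(Mⁿ,E,⟨,⟩,D,φ)` (`n ≥ 3`)
be an admissible GCF-manifold and `φ̌` the smooth extension of `v ↦ φ(Â(v))`.  Then
`(Mⁿ,E,⟨,⟩,D,φ̌)` is again an admissible GCF-manifold, and the double dual `φ̌̌`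
coincides with `φ`: `φ` is a dual homomorphism for the dual structure, and any dual
homomorphism of the dual structure agrees with `φ` on all of `U`. -/
theorem statement2 {n : ℕ} (d : Loc.CTB n) (hadm : d.IsAdmissible)
    (ψ : Loc.Pt n → Loc.Mat n) (hψ : d.IsDualHom ψ) :
    (Loc.CTB.mk d.U d.h d.ω ψ).IsAdmissible ∧
    (Loc.CTB.mk d.U d.h d.ω ψ).IsDualHom d.φ ∧
    (∀ χ : Loc.Pt n → Loc.Mat n,
      (Loc.CTB.mk d.U d.h d.ω ψ).IsDualHom χ → ∀ p ∈ d.U, χ p = d.φ p) := by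
  obtain ⟨⟨hn, hctb, hdens, hcf⟩, hstar, -⟩ := hadm
  obtain ⟨H, C⟩ := ctb_iff.1 hctb
  obtain ⟨sψ, eψ⟩ := hψ
  have P : DP d.U d.h d.ω d.φ ψ := mk_DP hn H C hdens hcf
    (fun p hp a b => sm_of_on H.op (sψ a b) hp) eψ
  have Q := P.swap
  -- non-parabolic points are regular for the dual homomorphism
  have hreg : d.regStar ⊆ {p | p ∈ d.U ∧ (ψ p).det ≠ 0} := by
    rintro p ⟨hp, hA⟩
    refine ⟨hp.1, ?_⟩
    rw [eψ p hp, Matrix.det_mul, CTB.Ahat, Matrix.det_mul]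
    refine mul_ne_zero hp.2 (mul_ne_zero ?_ hA)
    have := met_det H hp.1 hp.2
    rw [Matrix.det_nonsing_inv, Ring.inverse_eq_inv']
    exact inv_ne_zero this
  have hdual : (Loc.CTB.mk d.U d.h d.ω ψ).IsDualHom d.φ := by
    refine ⟨fun a j => on_of_sm fun p hp => C.sm p hp a j, fun p hp => ?_⟩
    exact (phi_Ahat hn H P.C' hp.1 hp.2 (Q.curv p hp.1) (Q.sym p hp.1)).symm
  have hd2 : d.U ⊆ closure {p | p ∈ d.U ∧ (ψ p).det ≠ 0} := hstar.trans (closure_mono hreg)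
  refine ⟨⟨⟨hn, ctb_iff.2 ⟨H, P.C'⟩, hd2, Q.cf⟩, ?_, d.φ, hdual⟩, hdual, ?_⟩
  · refine hstar.trans (closure_mono fun p hp => ⟨hreg hp, ?_⟩)
    have h2 := hreg hp
    have e := schouten_eq hn H P.C' h2.1 h2.2 (Q.curv p h2.1) (Q.sym p h2.1)
    have e' : (Loc.CTB.mk d.U d.h d.ω ψ).schoutenT p = (ψ p).transpose * d.h p * d.φ p := e
    rw [e', Matrix.det_mul, Matrix.det_mul, Matrix.det_transpose]
    exact mul_ne_zero (mul_ne_zero h2.2 (H.unit h2.1).ne_zero) hp.1.2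
  · rintro χ ⟨sχ, eχ⟩ p hp
    ext a b
    refine ext_dense (R := {p | p ∈ d.U ∧ (ψ p).det ≠ 0}) (fun p hp => hp.1) hd2
      (f := fun p => χ p a b) (g := fun p => d.φ p a b)
      (fun p hp => sm_of_on H.op (sχ a b) hp) (fun p hp => C.sm p hp a b) (fun p hp => ?_) p hp
    rw [eχ p hp, hdual.2 p hp]
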